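/- Let k, p ∈ ℕ and let (r, m₁, m₃) belong to the set {(2j, 2j-1, 2j-1) : j ∈ ℕ} ∪ {(2j+1, 2j-1, 2j) : j ∈ ℕ₀}. Then there exists a constant c > 0 depending only on k, r, p, and for every A_p ∈ 𝔸_p there exists N ∈ ℕ depending only on d(A_p), such that for every f ∈ C^r and every n ≥ N there exists a polynomial P_n of degree ≤ n satisfying: (1) P_n(x) ≥ f(x) for all x ∈ I (onesided approximation); (2) if m₁ ≥ 0 then P_n^(i)(α) = f^(i)(α) for all α ∈ A_p and 0 ≤ i ≤ m₁ (no condition if m₁ = -1); (3) P_n^(i)(±1) = f^(i)(±1) for 0 ≤ i ≤ m₃; and (4) |f(x) - P_n(x)| ≤ c ρ_n^r(x) ω_k(f^(r), ρ_n(x)) for all x ∈ I. -/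

import Mathlib

/-- The `k`-th modulus of smoothness of `g` with step bound `t` on `[a,b]`. -/
noncomputable def omegaK (g : ℝ → ℝ) (k : ℕ) (t a b : ℝ) : ℝ :=
  sSup {v : ℝ | ∃ h x : ℝ, 0 < h ∧ h ≤ t ∧ a ≤ x ∧ x + (k : ℝ) * h ≤ b ∧
    v = |∑ i ∈ Finset.range (k + 1),
      (-1 : ℝ) ^ (k - i) * (k.choose i : ℝ) * g (x + (i : ℝ) * h)|}

/-- `ρ_n(x) = n⁻¹ √(1 - x²) + n⁻²`. -/
noncomputable def rho (n : ℕ) (x : ℝ) : ℝ :=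
  Real.sqrt (1 - x ^ 2) / n + 1 / (n : ℝ) ^ 2

/-- The smallest positive distance between two distinct points of `S`. -/
noncomputable def minGap (S : Set ℝ) : ℝ :=
  sInf {d : ℝ | ∃ u ∈ S, ∃ v ∈ S, u ≠ v ∧ d = |u - v|}

section

open Set Polynomial

theorem fwdDiff_iter_eq_real_sum (g : ℝ → ℝ) (k : ℕ) (h x : ℝ) :
    (fwdDiff h)^[k] g x = ∑ i ∈ Finset.range (k + 1),
      (-1 : ℝ) ^ (k - i) * (k.choose i : ℝ) * g (x + (i : ℝ) * h) := by
  rw [fwdDiff_iter_eq_sum_shift]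
  refine Finset.sum_congr rfl fun i _ => ?_
  simp [zsmul_eq_mul]

theorem abs_fwdDiff_iter_le_omegaK {g : ℝ → ℝ} {k : ℕ} {a b h t x : ℝ}
    (hg : ContinuousOn g (Icc a b)) (hh : 0 < h) (hht : h ≤ t) (hx : a ≤ x)
    (hxb : x + k * h ≤ b) : |(fwdDiff h)^[k] g x| ≤ omegaK g k t a b := by
  obtain ⟨B, hB⟩ := isCompact_Icc.exists_bound_of_continuousOn hg
  rw [fwdDiff_iter_eq_real_sum]
  refine le_csSup ⟨∑ i ∈ Finset.range (k + 1), (k.choose i : ℝ) * B, ?_⟩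
    ⟨h, x, hh, hht, hx, hxb, rfl⟩
  rintro v ⟨h, x, hh, -, hx, hxb, rfl⟩
  refine (Finset.abs_sum_le_sum_abs _ _).trans (Finset.sum_le_sum fun i hi => ?_)
  have hi' : (i : ℝ) ≤ k := by exact_mod_cast Finset.mem_range_succ_iff.1 hi
  have hmem : x + i * h ∈ Icc a b :=
    ⟨by nlinarith [mul_nonneg (Nat.cast_nonneg (α := ℝ) i) hh.le], by nlinarith⟩
  rw [abs_mul, abs_mul, abs_pow, abs_neg, abs_one, one_pow, one_mul, Nat.abs_cast]
  exact mul_le_mul_of_nonneg_left (hB _ hmem) (Nat.cast_nonneg _)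

theorem omegaK_nonneg (g : ℝ → ℝ) (k : ℕ) (t a b : ℝ) : 0 ≤ omegaK g k t a b := by
  apply Real.sSup_nonneg
  rintro v ⟨h, x, -, -, -, -, rfl⟩
  exact abs_nonneg _

theorem fwdDiff_commute (h h' : ℝ) :
    Function.Commute (fwdDiff h : (ℝ → ℝ) → ℝ → ℝ) (fwdDiff h') := by
  intro u
  funext x
  simp only [fwdDiff]
  rw [add_right_comm]
  ring

theorem fwdDiff_nat_mul (u : ℝ → ℝ) (h : ℝ) (m : ℕ) (x : ℝ) :
    fwdDiff (m * h) u x = ∑ i ∈ Finset.range m, fwdDiff h u (x + i * h) := by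
  have := Finset.sum_range_sub (fun i : ℕ => u (x + i * h)) m
  simp only [fwdDiff]
  simp only [Nat.cast_zero, zero_mul, add_zero] at this
  rw [← this]
  refine Finset.sum_congr rfl fun i _ => ?_
  push_cast
  ring_nf

theorem abs_fwdDiff_iter_nat_mul_le {u : ℝ → ℝ} {a b h B : ℝ} {m : ℕ} (hh : 0 < h)
    (j l : ℕ)
    (hB : ∀ x, a ≤ x → x + (j + l : ℕ) * h ≤ b → |(fwdDiff h)^[j + l] u x| ≤ B) :
    ∀ x, a ≤ x → x + (j * m + l : ℕ) * h ≤ b →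
      |(fwdDiff (m * h))^[j] ((fwdDiff h)^[l] u) x| ≤ (m : ℝ) ^ j * B := by
  induction j generalizing l with
  | zero => simpa using hB
  | succ j ih =>
    intro x hx hxb
    rw [Function.iterate_succ_apply', fwdDiff_nat_mul]
    have key : ∀ i ∈ Finset.range m,
        |fwdDiff h ((fwdDiff (m * h))^[j] ((fwdDiff h)^[l] u)) (x + i * h)|
          ≤ (m : ℝ) ^ j * B := by
      intro i hi
      have hi' : (i : ℝ) + 1 ≤ m := by exact_mod_cast Finset.mem_range.1 hi
      rw [((fwdDiff_commute h (m * h)).iterate_right j).eq, ← Function.iterate_succ_apply' (fwdDiff h)]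
      refine ih (l + 1) ?_ _ ?_ ?_
      · rwa [← add_assoc, add_right_comm]
      · nlinarith [mul_nonneg (Nat.cast_nonneg (α := ℝ) i) hh.le]
      · push_cast at hxb ⊢
        nlinarith
    calc _ ≤ ∑ i ∈ Finset.range m, (m : ℝ) ^ j * B :=
          (Finset.abs_sum_le_sum_abs _ _).trans (Finset.sum_le_sum key)
      _ = _ := by simp; ring

theorem omegaK_le_nat_pow_mul {g : ℝ → ℝ} {k m : ℕ} {a b s t : ℝ}
    (hg : ContinuousOn g (Icc a b)) (hm : 1 ≤ m) (hst : s ≤ m * t) :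
    omegaK g k s a b ≤ (m : ℝ) ^ k * omegaK g k t a b := by
  have hm0 : (0 : ℝ) < m := by exact_mod_cast hm
  refine Real.sSup_le ?_ (mul_nonneg (by positivity) (omegaK_nonneg _ _ _ _ _))
  rintro v ⟨h, x, hh, hhs, hx, hxb, rfl⟩
  rw [← fwdDiff_iter_eq_real_sum]
  have hh' : 0 < h / m := by positivity
  have hht : h / m ≤ t := by
    rw [div_le_iff₀ hm0]; linarith
  have := abs_fwdDiff_iter_nat_mul_le (u := g) (a := a) (b := b) (m := m) hh' k 0
    (fun x hx hxb => by
      simpa using abs_fwdDiff_iter_le_omegaK hg hh' hht hx (by simpa using hxb)) x hx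
    (by push_cast; rw [add_zero, mul_assoc, mul_div_cancel₀ _ hm0.ne']; exact hxb)
  rwa [mul_div_cancel₀ _ hm0.ne'] at this

/-- The `k`-fold Steklov mean of `G` with step `c`. -/
noncomputable def steklov (c : ℝ) : ℕ → (ℝ → ℝ) → ℝ → ℝ
  | 0, G => G
  | k + 1, G => fun x => ∫ t in (0 : ℝ)..1, steklov c k G (x + c * t)

theorem continuous_steklov {G : ℝ → ℝ} (hG : Continuous G) (c : ℝ) (k : ℕ) :
    Continuous (steklov c k G) := by
  induction k with
  | zero => exact hG
  | succ k ih =>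
    refine intervalIntegral.continuous_parametric_intervalIntegral_of_continuous' ?_ _ _
    exact ih.comp (by fun_prop)

theorem abs_sum_steklov_le {G : ℝ → ℝ} (hG : Continuous G) {ι : Type*} (S : Finset ι)
    (a c : ι → ℝ) {B : ℝ} (k : ℕ) (x : ι → ℝ)
    (hB : ∀ s ∈ Icc (0 : ℝ) k, |∑ i ∈ S, a i * G (x i + c i * s)| ≤ B) :
    |∑ i ∈ S, a i * steklov (c i) k G (x i)| ≤ B := by
  induction k generalizing x with
  | zero => simpa [steklov] using hB 0 (by simp)
  | succ k ih =>
    have hcont : ∀ i, Continuous fun t => steklov (c i) k G (x i + c i * t) := fun i =>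
      (continuous_steklov hG _ _).comp (by fun_prop)
    have hint : ∑ i ∈ S, a i * steklov (c i) (k + 1) G (x i) =
        ∫ t in (0 : ℝ)..1, ∑ i ∈ S, a i * steklov (c i) k G (x i + c i * t) := by
      rw [intervalIntegral.integral_finsetSum]
      · simp only [steklov, intervalIntegral.integral_const_mul]
      · exact fun i _ => ((hcont i).const_mul _).intervalIntegrable _ _
    rw [hint]
    have := intervalIntegral.norm_integral_le_of_norm_le_const (a := (0 : ℝ)) (b := 1) (C := B)
      (f := fun t => ∑ i ∈ S, a i * steklov (c i) k G (x i + c i * t)) ?_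
    · simpa using this
    · intro t ht
      rw [uIoc_of_le zero_le_one] at ht
      refine ih _ fun s hs => ?_
      have := hB (t + s) ⟨by linarith [ht.1, hs.1], by push_cast; linarith [ht.2, hs.2]⟩
      simpa [mul_add, add_assoc] using this

theorem hasDerivAt_steklov_succ {G : ℝ → ℝ} (hG : Continuous G) {c : ℝ} (hc : c ≠ 0)
    (k : ℕ) (x : ℝ) :
    HasDerivAt (steklov c (k + 1) G) (c⁻¹ * fwdDiff c (steklov c k G) x) x := by
  have hS := continuous_steklov hG c k
  have heq : steklov c (k + 1) G = fun x =>
      c⁻¹ * ((∫ t in (0 : ℝ)..(x + c), steklov c k G t) - ∫ t in (0 : ℝ)..x, steklov c k G t) := by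
    funext y
    rw [intervalIntegral.integral_interval_sub_left (hS.intervalIntegrable _ _)
      (hS.intervalIntegrable _ _)]
    simp only [steklov]
    rw [intervalIntegral.integral_comp_add_mul _ hc]
    simp
  rw [heq]
  have h1 : ∀ y, HasDerivAt (fun u => ∫ t in (0 : ℝ)..u, steklov c k G t) (steklov c k G y) y :=
    fun y => intervalIntegral.integral_hasDerivAt_right (hS.intervalIntegrable _ _)
      (hS.stronglyMeasurableAtFilter _ _) hS.continuousAt
  have h2 := (h1 (x + c)).comp_add_const x c
  exact (h2.sub (h1 x)).const_mul _

theorem HasDerivAt.fwdDiff_iter {F F' : ℝ → ℝ} (hF : ∀ x, HasDerivAt F (F' x) x) (c : ℝ)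
    (n : ℕ) (x : ℝ) : HasDerivAt ((fwdDiff c)^[n] F) ((fwdDiff c)^[n] F' x) x := by
  induction n generalizing F F' with
  | zero => exact hF x
  | succ n ih =>
    rw [Function.iterate_succ_apply, Function.iterate_succ_apply]
    exact ih fun y => ((hF (y + c)).comp_add_const y c).sub (hF y)

/-- The derivative of order `j` of the `k`-fold Steklov mean, for `j ≤ k`. -/
noncomputable def steklovDeriv (c : ℝ) (k : ℕ) (G : ℝ → ℝ) (j : ℕ) (x : ℝ) : ℝ :=
  c⁻¹ ^ j * (fwdDiff c)^[j] (steklov c (k - j) G) x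

theorem hasDerivAt_steklovDeriv {G : ℝ → ℝ} (hG : Continuous G) {c : ℝ} (hc : c ≠ 0)
    {k j : ℕ} (hj : j < k) (x : ℝ) :
    HasDerivAt (steklovDeriv c k G j) (steklovDeriv c k G (j + 1) x) x := by
  obtain ⟨l, rfl⟩ : ∃ l, k = j + (l + 1) := ⟨k - j - 1, by omega⟩
  have h := (HasDerivAt.fwdDiff_iter (hasDerivAt_steklov_succ hG hc l) c j x).const_mul (c⁻¹ ^ j)
  have e1 : j + (l + 1) - j = l + 1 := by omega
  have e2 : j + (l + 1) - (j + 1) = l := by omega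
  unfold steklovDeriv
  rw [e1, e2]
  refine h.congr_deriv ?_
  rw [Function.iterate_succ_apply]
  change c⁻¹ ^ j * (fwdDiff c)^[j] (c⁻¹ • fwdDiff c (steklov c l G)) x = _
  rw [fwdDiff_iter_const_smul]
  simp [pow_succ, mul_assoc]

/-- Taylor's estimate for a chain of successive derivatives vanishing at `y`. -/
theorem abs_le_of_hasDerivWithinAt_chain {a b y : ℝ} (hy : y ∈ Icc a b) {B : ℝ → ℝ}
    (hB : Monotone B) (k : ℕ) (F : ℕ → ℝ → ℝ)
    (hF : ∀ j < k, ∀ x ∈ Icc a b, HasDerivWithinAt (F j) (F (j + 1) x) (Icc a b) x)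
    (hFy : ∀ j < k, F j y = 0) (hk : ∀ x ∈ Icc a b, |F k x| ≤ B |x - y|) :
    ∀ x ∈ Icc a b, |F 0 x| ≤ |x - y| ^ k * B |x - y| := by
  induction k generalizing F with
  | zero => simpa using hk
  | succ k ih =>
    intro x hx
    have h1 := ih (fun j => F (j + 1)) (fun j hj => hF (j + 1) (by omega))
      (fun j hj => hFy (j + 1) (by omega)) hk
    have hB0 : 0 ≤ B |x - y| := (abs_nonneg _).trans (hk x hx)
    have hsub : uIcc y x ⊆ Icc a b := uIcc_subset_Icc hy hx
    have hmv := Convex.norm_image_sub_le_of_norm_hasDerivWithin_le (f := F 0) (f' := F 1)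
      (s := uIcc y x) (x := y) (y := x) (C := |x - y| ^ k * B |x - y|)
      (fun z hz => (hF 0 (by omega) z (hsub hz)).mono hsub) ?_ (convex_uIcc y x)
      left_mem_uIcc right_mem_uIcc
    · rw [hFy 0 (by omega), sub_zero, Real.norm_eq_abs, Real.norm_eq_abs] at hmv
      rw [pow_succ]
      linarith
    · intro z hz
      have hzy : |z - y| ≤ |x - y| := abs_sub_left_of_mem_uIcc hz
      refine (h1 z (hsub hz)).trans ?_
      have := hB hzy
      have hBz : 0 ≤ B |z - y| := (abs_nonneg _).trans (hk z (hsub hz))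
      gcongr

theorem exists_polynomial_antiderivative (q : ℝ[X]) (y v : ℝ) :
    ∃ p : ℝ[X], derivative p = q ∧ p.eval y = v ∧ p.natDegree ≤ q.natDegree + 1 := by
  obtain ⟨p, hp, hd⟩ : ∃ p : ℝ[X], derivative p = q ∧ p.natDegree ≤ q.natDegree + 1 := by
    refine ⟨∑ i ∈ Finset.range (q.natDegree + 1), C (q.coeff i / (i + 1)) * X ^ (i + 1), ?_, ?_⟩
    · conv_rhs => rw [q.as_sum_range_C_mul_X_pow]
      rw [derivative_sum]
      refine Finset.sum_congr rfl fun i _ => ?_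
      rw [derivative_C_mul_X_pow]
      congr 2
      push_cast
      field_simp
    · refine natDegree_sum_le_of_forall_le _ _ fun i hi => ?_
      refine (natDegree_C_mul_X_pow_le _ _).trans ?_
      have := Finset.mem_range.1 hi
      omega
  refine ⟨p + C (v - p.eval y), by simp [hp], by simp, ?_⟩
  exact (natDegree_add_le _ _).trans (by simpa using hd)

theorem exists_polynomial_iterate_derivative_eq (q : ℝ[X]) (y : ℝ) (r : ℕ) (v : ℕ → ℝ) :
    ∃ p : ℝ[X], derivative^[r] p = q ∧ (∀ i < r, (derivative^[i] p).eval y = v i) ∧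
      p.natDegree ≤ q.natDegree + r := by
  induction r generalizing v with
  | zero => exact ⟨q, rfl, by simp, by simp⟩
  | succ r ih =>
    obtain ⟨p, hp, hpv, hd⟩ := ih fun i => v (i + 1)
    obtain ⟨P, hP, hPv, hPd⟩ := exists_polynomial_antiderivative p y (v 0)
    refine ⟨P, by rw [Function.iterate_succ_apply, hP, hp], fun i hi => ?_, by omega⟩
    cases i with
    | zero => simpa using hPv
    | succ i => rw [Function.iterate_succ_apply, hP, hpv i (by omega)]

theorem steklov_zero (k : ℕ) (G : ℝ → ℝ) (x : ℝ) : steklov 0 k G x = G x := by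
  induction k generalizing x with
  | zero => rfl
  | succ k ih => simp [steklov, ih]

theorem omegaK_congr {g g' : ℝ → ℝ} {a b : ℝ} (h : EqOn g g' (Icc a b)) (k : ℕ) (t : ℝ) :
    omegaK g k t a b = omegaK g' k t a b := by
  unfold omegaK
  congr 1
  ext v
  refine exists_congr fun s => exists_congr fun x => ?_
  refine and_congr_right fun hs => and_congr_right fun _ => and_congr_right fun hx =>
    and_congr_right fun hxb => ?_
  have : ∑ i ∈ Finset.range (k + 1), (-1 : ℝ) ^ (k - i) * (k.choose i : ℝ) * g (x + (i : ℝ) * s)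
      = ∑ i ∈ Finset.range (k + 1),
        (-1 : ℝ) ^ (k - i) * (k.choose i : ℝ) * g' (x + (i : ℝ) * s) := by
    refine Finset.sum_congr rfl fun i hi => ?_
    have hi' : (i : ℝ) ≤ k := by exact_mod_cast Finset.mem_range_succ_iff.1 hi
    rw [h ⟨by nlinarith [mul_nonneg (Nat.cast_nonneg (α := ℝ) i) hs.le], by nlinarith⟩]
  rw [this]

theorem sum_choose_succ_le (k : ℕ) :
    ∑ i ∈ Finset.range k, (k.choose (i + 1) : ℝ) ≤ 2 ^ k := by
  have h : ∑ i ∈ Finset.range (k + 1), (k.choose i : ℝ) = 2 ^ k := by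
    exact_mod_cast Nat.sum_range_choose k
  rw [Finset.sum_range_succ'] at h
  linarith [Nat.cast_nonneg (α := ℝ) (k.choose 0)]

theorem sum_choose_le (k : ℕ) :
    ∑ i ∈ Finset.range k, (k.choose i : ℝ) ≤ 2 ^ k := by
  have h : ∑ i ∈ Finset.range (k + 1), (k.choose i : ℝ) = 2 ^ k := by
    exact_mod_cast Nat.sum_range_choose k
  rw [Finset.sum_range_succ] at h
  linarith [Nat.cast_nonneg (α := ℝ) (k.choose k)]

theorem fwdDiff_iter_eval_eq_zero {k : ℕ} {q : ℝ[X]} (hq : q.natDegree < k) (h x : ℝ) :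
    (fwdDiff h)^[k] (fun z => q.eval z) x = 0 := by
  have hdeg : (q.comp (C x + C h * X)).natDegree < k := by
    refine (natDegree_comp_le.trans ?_).trans_lt hq
    refine (Nat.mul_le_mul_left _ (?_ : _ ≤ 1)).trans (by simp)
    refine (natDegree_add_le _ _).trans ?_
    simpa using natDegree_C_mul_le h (X : ℝ[X])
  have := congrFun (Polynomial.fwdDiff_iter_eq_zero_of_degree_lt hdeg) 0
  rw [fwdDiff_iter_eq_real_sum] at this ⊢
  simpa [mul_comm h] using this

theorem abs_le_of_fwdDiff_iter {e : ℝ → ℝ} {k : ℕ} {h x B D : ℝ}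
    (hD : |(fwdDiff h)^[k] e (x - k * h)| ≤ D) (hB0 : 0 ≤ B)
    (hB : ∀ i < k, |e (x - k * h + i * h)| ≤ B) : |e x| ≤ D + 2 ^ k * B := by
  rw [fwdDiff_iter_eq_real_sum, Finset.sum_range_succ] at hD
  simp only [Nat.sub_self, pow_zero, Nat.choose_self, Nat.cast_one, one_mul,
    sub_add_cancel] at hD
  set R := ∑ i ∈ Finset.range k, (-1 : ℝ) ^ (k - i) * (k.choose i : ℝ) *
    e (x - k * h + i * h)
  have hR : |R| ≤ 2 ^ k * B := by
    refine (Finset.abs_sum_le_sum_abs _ _).trans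
      ((Finset.sum_le_sum (g := fun i => (k.choose i : ℝ) * B) fun i hi => ?_).trans ?_)
    · rw [abs_mul, abs_mul, abs_pow, abs_neg, abs_one, one_pow, one_mul, Nat.abs_cast]
      exact mul_le_mul_of_nonneg_left (hB i (Finset.mem_range.1 hi)) (Nat.cast_nonneg _)
    · rw [← Finset.sum_mul]
      exact mul_le_mul_of_nonneg_right (sum_choose_le k) hB0
  have : e x = (R + e x) - R := by ring
  rw [this]
  exact (abs_sub _ _).trans (add_le_add hD hR)

/-- A smooth approximation of `G` on `[-1, 1 - k h]` at scale `h`, with its derivatives. -/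
theorem exists_smoothing {k : ℕ} (hk : 1 ≤ k) {G : ℝ → ℝ} (hG : Continuous G) {h : ℝ}
    (hh : 0 < h) :
    ∃ F : ℕ → ℝ → ℝ, (∀ j < k, ∀ x, HasDerivAt (F j) (F (j + 1) x) x) ∧
      (∀ x ∈ Icc (-1 : ℝ) (1 - k * h), |G x - F 0 x| ≤ omegaK G k h (-1) 1) ∧
      ∀ x ∈ Icc (-1 : ℝ) (1 - k * h),
        |F k x| ≤ (2 * k / h) ^ k * omegaK G k h (-1) 1 := by
  have hk0 : (0 : ℝ) < k := by exact_mod_cast hk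
  set δ := h / k with hδ
  have hδ0 : 0 < δ := by positivity
  have hkδ : k * δ = h := by rw [hδ]; field_simp
  set a : ℕ → ℝ := fun i => (-1) ^ (k - i) * (k.choose i : ℝ) with ha
  have habs : ∀ i, |a i| = k.choose i := by
    intro i; simp [ha, abs_mul, abs_pow]
  refine ⟨fun j x => ∑ i ∈ Finset.range k,
    -((-1) ^ k * a (i + 1)) * steklovDeriv ((i + 1 : ℕ) * δ) k G j x, ?_, ?_, ?_⟩
  · intro j hj x
    refine HasDerivAt.fun_sum fun i _ => ?_
    exact (hasDerivAt_steklovDeriv hG (by positivity) hj x).const_mul _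
  · intro x hx
    have h1 := abs_sum_steklov_le hG (Finset.range (k + 1)) a (fun i => (i : ℝ) * δ)
      (B := omegaK G k h (-1) 1) k (fun _ => x) ?_
    · rw [Finset.sum_range_succ'] at h1
      have hs : ((-1 : ℝ) ^ k) * (-1) ^ k = 1 := by rw [← mul_pow]; simp
      have h2 : G x - ∑ i ∈ Finset.range k,
          -((-1) ^ k * a (i + 1)) * steklovDeriv ((i + 1 : ℕ) * δ) k G 0 x =
          (-1) ^ k * (∑ i ∈ Finset.range k,
            a (i + 1) * steklov (((i + 1 : ℕ) : ℝ) * δ) k G x +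
            a 0 * steklov (((0 : ℕ) : ℝ) * δ) k G x) := by
        rw [mul_add, Finset.mul_sum]
        simp only [Nat.cast_zero, zero_mul, steklov_zero, steklovDeriv, ha, tsub_zero,
          Nat.choose_zero_right, Nat.cast_one, mul_one, pow_zero, one_mul,
          Function.iterate_zero, id]
        rw [← mul_assoc, hs, one_mul, add_comm, sub_eq_add_neg, ← Finset.sum_neg_distrib]
        congr 1
        refine Finset.sum_congr rfl fun i _ => ?_
        ring
      rw [h2, abs_mul, abs_pow, abs_neg, abs_one, one_pow, one_mul]
      exact h1
    · intro s hs
      have hsum : ∑ i ∈ Finset.range (k + 1), a i * G (x + i * δ * s) =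
          (fwdDiff (δ * s))^[k] G x := by
        rw [fwdDiff_iter_eq_real_sum]
        refine Finset.sum_congr rfl fun i _ => ?_
        rw [mul_assoc (i : ℝ)]
      rw [hsum]
      rcases hs.1.eq_or_lt with h0 | h0
      · obtain ⟨l, rfl⟩ : ∃ l, k = l + 1 := ⟨k - 1, by omega⟩
        have hz : fwdDiff (0 : ℝ) G = 0 := by funext z; simp [fwdDiff]
        have hz' : (fwdDiff (0 : ℝ))^[l] (0 : ℝ → ℝ) = 0 := by
          refine Function.iterate_fixed ?_ l
          funext z; simp [fwdDiff]
        rw [← h0, mul_zero, Function.iterate_succ_apply, hz, hz']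
        simpa using omegaK_nonneg _ _ _ _ _
      · have hle : δ * s ≤ h := by
          rw [← hkδ, mul_comm]; exact mul_le_mul_of_nonneg_right hs.2 hδ0.le
        refine abs_fwdDiff_iter_le_omegaK hG.continuousOn (by positivity) hle hx.1 ?_
        have := mul_le_mul_of_nonneg_left hle hk0.le
        linarith [hx.2]
  · intro x hx
    have hω := omegaK_nonneg G k h (-1) 1
    have hterm : ∀ i ∈ Finset.range k,
        |-((-1) ^ k * a (i + 1)) * steklovDeriv ((i + 1 : ℕ) * δ) k G k x| ≤
          k.choose (i + 1) * ((k / h) ^ k * omegaK G k h (-1) 1) := by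
      intro i hi
      have hi1 : ((i + 1 : ℕ) : ℝ) ≤ k := by exact_mod_cast Finset.mem_range.1 hi
      have hi0 : (1 : ℝ) ≤ ((i + 1 : ℕ) : ℝ) := by exact_mod_cast Nat.succ_pos i
      set c := ((i + 1 : ℕ) : ℝ) * δ with hc
      have hcδ : δ ≤ c := le_mul_of_one_le_left hδ0.le hi0
      have hch : c ≤ h := by
        rw [← hkδ]; exact mul_le_mul_of_nonneg_right hi1 hδ0.le
      have hc0 : 0 < c := hδ0.trans_le hcδ
      rw [abs_mul, abs_neg, abs_mul, abs_pow, abs_neg, abs_one, one_pow, one_mul, habs]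
      refine mul_le_mul_of_nonneg_left ?_ (Nat.cast_nonneg _)
      rw [steklovDeriv, abs_mul, abs_pow, abs_inv, abs_of_pos hc0, Nat.sub_self]
      refine mul_le_mul ?_ ?_ (abs_nonneg _) (by positivity)
      · have : c⁻¹ ≤ k / h := by
          rw [← inv_div]
          exact inv_anti₀ hδ0 hcδ
        exact pow_le_pow_left₀ (by positivity) this _
      · refine abs_fwdDiff_iter_le_omegaK hG.continuousOn hc0 hch hx.1 ?_
        have := mul_le_mul_of_nonneg_left hch hk0.le
        linarith [hx.2]
    refine (Finset.abs_sum_le_sum_abs _ _).trans ((Finset.sum_le_sum hterm).trans ?_)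
    rw [← Finset.sum_mul, mul_div_assoc, mul_pow, mul_assoc]
    exact mul_le_mul_of_nonneg_right (sum_choose_succ_le k) (by positivity)

/-- A Whitney type estimate: near `y` at scale `h`, a continuous function is approximated by a
polynomial of degree less than `k` with an error growing polynomially in `|x - y| / h`. -/
theorem exists_polynomial_whitney {k : ℕ} (hk : 1 ≤ k) :
    ∃ A : ℝ, 0 ≤ A ∧ ∀ g : ℝ → ℝ, ContinuousOn g (Icc (-1) 1) → ∀ y ∈ Icc (-1 : ℝ) 1,
      ∀ h : ℝ, 0 < h → 2 * (k : ℝ) ^ 2 * h ≤ 1 →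
      ∃ q : ℝ[X], q.natDegree < k ∧ ∀ x ∈ Icc (-1 : ℝ) 1,
        |g x - q.eval x| ≤ A * (1 + |x - y| / h) ^ k * omegaK g k h (-1) 1 := by
  have hk1 : (1 : ℝ) ≤ k := by exact_mod_cast hk
  set A₁ : ℝ := 1 + (2 * k * k) ^ k with hA₁
  have hA₁0 : 0 ≤ A₁ := by positivity
  refine ⟨k ^ k + 2 ^ k * (A₁ * (1 + k ^ 2) ^ k), by positivity, ?_⟩
  intro g hg y hy h hh hkh
  set G : ℝ → ℝ := fun x => g (max (-1) (min 1 x)) with hGdef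
  have hG : Continuous G := by
    refine hg.comp_continuous (by fun_prop) fun x => ⟨le_max_left _ _, ?_⟩
    exact max_le (by norm_num) (min_le_left _ _)
  have hGg : EqOn G g (Icc (-1) 1) := by
    intro x hx
    simp only [hGdef]
    rw [min_eq_right hx.2, max_eq_right hx.1]
  rw [← omegaK_congr hGg]
  set ω := omegaK G k h (-1) 1 with hωdef
  have hω : 0 ≤ ω := omegaK_nonneg _ _ _ _ _
  obtain ⟨F, hF, hF0, hFk⟩ := exists_smoothing hk hG hh
  have hkk : k * h ≤ k ^ 2 * h := by
    rw [pow_two, mul_assoc]; exact le_mul_of_one_le_left (by positivity) hk1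
  set b := 1 - k * h with hb
  set y' := min y b with hy'
  have hb1 : 1 / 2 ≤ b := by nlinarith
  have hy'mem : y' ∈ Icc (-1 : ℝ) b := ⟨le_min hy.1 (by linarith), min_le_right _ _⟩
  have hyy' : |y' - y| ≤ k * h := by
    rw [abs_le]
    constructor
    · rw [hy']
      rcases min_cases y b with ⟨h1, _⟩ | ⟨h1, _⟩ <;> rw [h1] <;> nlinarith [hy.2]
    · have := min_le_left y b
      nlinarith
  obtain ⟨q, hq, hqv, hqd⟩ := exists_polynomial_iterate_derivative_eq (C (F (k - 1) y')) y' (k - 1)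
    fun i => F i y'
  have hqk : q.natDegree < k := by
    rw [natDegree_C] at hqd; omega
  have near : ∀ x ∈ Icc (-1 : ℝ) b, |G x - q.eval x| ≤ A₁ * (1 + |x - y| / h) ^ k * ω := by
    intro x hx
    have hch := abs_le_of_hasDerivWithinAt_chain hy'mem
      (B := fun _ => (2 * k / h) ^ k * ω) monotone_const k
      (fun j x => F j x - (derivative^[j] q).eval x) ?_ ?_ ?_ x hx
    · have hu : |x - y'| / h ≤ k * (1 + |x - y| / h) := by
        have h1 : |x - y'| ≤ |x - y| + k * h := by
          have := abs_sub_le x y y'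
          rw [abs_sub_comm y y'] at this
          linarith
        rw [div_le_iff₀ hh]
        have h2 : k * (1 + |x - y| / h) * h = k * h + k * |x - y| := by field_simp
        rw [h2]
        nlinarith [abs_nonneg (x - y)]
      have h3 : |x - y'| ^ k * ((2 * k / h) ^ k * ω) ≤
          (2 * k * k) ^ k * (1 + |x - y| / h) ^ k * ω := by
        rw [← mul_assoc, ← mul_pow, ← mul_pow]
        refine mul_le_mul_of_nonneg_right (pow_le_pow_left₀ (by positivity) ?_ _) hω
        calc |x - y'| * (2 * k / h) = 2 * k * (|x - y'| / h) := by ring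
          _ ≤ 2 * k * (k * (1 + |x - y| / h)) := by gcongr
          _ = _ := by ring
      have h4 : ω ≤ (1 + |x - y| / h) ^ k * ω := by
        refine le_mul_of_one_le_left hω (one_le_pow₀ ?_)
        linarith [div_nonneg (abs_nonneg (x - y)) hh.le]
      have h5 : |G x - q.eval x| ≤ |G x - F 0 x| + |F 0 x - q.eval x| := abs_sub_le _ _ _
      have h6 := hF0 x hx
      simp only [Function.iterate_zero, id] at hch
      calc _ ≤ ω + (2 * k * k) ^ k * (1 + |x - y| / h) ^ k * ω := by linarith
        _ ≤ (1 + |x - y| / h) ^ k * ω + (2 * k * k) ^ k * (1 + |x - y| / h) ^ k * ω := by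
          linarith
        _ = _ := by rw [hA₁]; ring
    · intro j hj z _
      refine ((hF j hj z).sub ?_).hasDerivWithinAt
      simpa only [Function.iterate_succ_apply'] using (derivative^[j] q).hasDerivAt z
    · intro j hj
      rcases (by omega : j < k - 1 ∨ j = k - 1) with h1 | rfl
      · simp [hqv j h1]
      · simp [hq]
    · intro z hz
      simpa [iterate_derivative_eq_zero hqk] using hFk z hz
  have hA : A₁ ≤ k ^ k + 2 ^ k * (A₁ * (1 + k ^ 2) ^ k) := by
    have h1 : (1 : ℝ) ≤ (1 + k ^ 2) ^ k := one_le_pow₀ (by nlinarith)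
    have h2 : (1 : ℝ) ≤ 2 ^ k := one_le_pow₀ (by norm_num)
    have h3 : A₁ ≤ A₁ * (1 + k ^ 2) ^ k := le_mul_of_one_le_right hA₁0 h1
    have h4 := le_mul_of_one_le_left (hA₁0.trans h3) h2
    have : (0 : ℝ) ≤ k ^ k := by positivity
    linarith
  refine ⟨q, hqk, fun x hx => ?_⟩
  rw [← hGg hx]
  set u := |x - y| / h with hu
  have hu0 : 0 ≤ u := by positivity
  rcases le_or_gt x b with hxb | hxb
  · refine (near x ⟨hx.1, hxb⟩).trans ?_
    gcongr
  · set H := k * h with hH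
    have hH0 : 0 < H := by positivity
    have hkH : k * H = k ^ 2 * h := by rw [hH]; ring
    have hD : |(fwdDiff H)^[k] G (x - k * H)| ≤ k ^ k * ω := by
      refine (abs_fwdDiff_iter_le_omegaK (a := -1) (b := 1) (t := H) hG.continuousOn hH0 le_rfl
        ?_ ?_).trans (omegaK_le_nat_pow_mul hG.continuousOn hk le_rfl)
      · nlinarith
      · linarith [hx.2]
    have hDq : |(fwdDiff H)^[k] (fun z => G z - q.eval z) (x - k * H)| ≤ k ^ k * ω := by
      have h0 := fwdDiff_iter_eval_eq_zero hqk H (x - k * H)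
      have h1 : (fwdDiff H)^[k] (fun z => G z - q.eval z) (x - k * H) =
          (fwdDiff H)^[k] G (x - k * H) := by
        rw [fwdDiff_iter_eq_real_sum] at h0 ⊢
        rw [fwdDiff_iter_eq_real_sum]
        simp only [mul_sub, Finset.sum_sub_distrib]
        linarith
      rwa [h1]
    have h9 := abs_le_of_fwdDiff_iter (e := fun z => G z - q.eval z) hDq
      (B := A₁ * ((1 + k ^ 2) ^ k * (1 + u) ^ k) * ω) (by positivity) ?_
    · refine h9.trans ?_
      have h10 : (k : ℝ) ^ k * ω ≤ k ^ k * (1 + u) ^ k * ω := by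
        refine mul_le_mul_of_nonneg_right (le_mul_of_one_le_right (by positivity) ?_) hω
        exact one_le_pow₀ (by linarith)
      calc _ ≤ k ^ k * (1 + u) ^ k * ω + 2 ^ k * (A₁ * ((1 + k ^ 2) ^ k * (1 + u) ^ k) * ω) := by
            linarith
        _ = _ := by ring
    · intro i hi
      have hi1 : (i : ℝ) + 1 ≤ k := by exact_mod_cast hi
      have hi2 : H ≤ (k - i) * H := le_mul_of_one_le_left hH0.le (by linarith)
      have hi3 : (k - i) * H ≤ k * H :=
        mul_le_mul_of_nonneg_right (by linarith [Nat.cast_nonneg (α := ℝ) i]) hH0.le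
      have e : x - k * H + i * H = x - (k - i) * H := by ring
      rw [e]
      refine (near _ ⟨by linarith, by linarith [hx.2]⟩).trans ?_
      rw [← mul_pow]
      have hdist : |x - (k - i) * H - y| / h ≤ u + k ^ 2 := by
        rw [div_le_iff₀ hh, add_mul, hu, div_mul_cancel₀ _ hh.ne', ← hkH]
        have e : x - (k - i) * H - y = (x - y) - (k - i) * H := by ring
        rw [e]
        refine (abs_sub _ _).trans ?_
        rw [abs_of_nonneg (hH0.le.trans hi2)]
        linarith
      have h7 : 1 + |x - (k - i) * H - y| / h ≤ (1 + k ^ 2) * (1 + u) := by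
        have := mul_nonneg hu0 (sq_nonneg (k : ℝ))
        linarith
      have h8 : 0 ≤ 1 + |x - (k - i) * H - y| / h := by positivity
      gcongr

theorem eval_iterate_derivative_eq_zero_of_dvd {P : ℝ[X]} {a : ℝ} {s i : ℕ}
    (h : (X - C a) ^ s ∣ P) (hi : i < s) : (derivative^[i] P).eval a = 0 := by
  have h1 := pow_sub_dvd_iterate_derivative_of_pow_dvd i h
  obtain ⟨l, hl⟩ : ∃ l, s - i = l + 1 := ⟨s - i - 1, by omega⟩
  rw [hl] at h1
  exact dvd_iff_isRoot.1 ((dvd_pow_self _ (Nat.succ_ne_zero l)).trans h1)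

theorem exists_nonneg_polynomial_vanishing (r : ℕ) {y : ℝ} {h : ℝ} (hh : 0 < h) :
    ∃ B : ℝ[X], B.natDegree ≤ r ∧ (∀ x ∈ Icc (-1 : ℝ) 1, 0 ≤ B.eval x ∧
      |x - y| ^ r ≤ B.eval x * (1 + |x - y| / h) ∧
      B.eval x ≤ h ^ r * (1 + |x - y| / h) ^ r) ∧
      (X - C y) ^ (2 * (r / 2)) ∣ B ∧ (y = 1 ∨ y = -1 → (X - C y) ^ r ∣ B) := by
  have habs : ∀ x : ℝ, |x - y| ^ r ≤ |x - y| ^ r * (1 + |x - y| / h) ∧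
      |x - y| ^ r ≤ h ^ r * (1 + |x - y| / h) ^ r := by
    intro x
    have hu : 0 ≤ |x - y| / h := by positivity
    refine ⟨le_mul_of_one_le_right (by positivity) (by linarith), ?_⟩
    rw [← mul_pow]
    refine pow_le_pow_left₀ (abs_nonneg _) ?_ _
    rw [mul_add, mul_div_cancel₀ _ hh.ne']
    linarith
  by_cases hy : y = 1 ∨ y = -1
  · have hd : (X - C y) ^ (2 * (r / 2)) ∣ (X - C y) ^ r := pow_dvd_pow _ (Nat.mul_div_le r 2)
    have key : ∀ B : ℝ[X], B.natDegree ≤ r → (X - C y) ^ r ∣ B →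
        (∀ x ∈ Icc (-1 : ℝ) 1, B.eval x = |x - y| ^ r) →
        ∃ B : ℝ[X], B.natDegree ≤ r ∧ (∀ x ∈ Icc (-1 : ℝ) 1, 0 ≤ B.eval x ∧
          |x - y| ^ r ≤ B.eval x * (1 + |x - y| / h) ∧
          B.eval x ≤ h ^ r * (1 + |x - y| / h) ^ r) ∧
          (X - C y) ^ (2 * (r / 2)) ∣ B ∧ (y = 1 ∨ y = -1 → (X - C y) ^ r ∣ B) := by
      intro B hB hdvd hBx
      refine ⟨B, hB, fun x hx => ?_, hd.trans hdvd, fun _ => hdvd⟩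
      rw [hBx x hx]
      exact ⟨by positivity, habs x⟩
    have hdeg : ((X - C y) ^ r : ℝ[X]).natDegree ≤ r := by
      simp
    rcases hy with rfl | rfl
    · refine key ((-1) ^ r * (X - C 1) ^ r) ?_ (dvd_mul_left _ _) fun x hx => ?_
      · refine natDegree_mul_le.trans ?_
        have : ((-1 : ℝ[X]) ^ r).natDegree = 0 := by
          rw [← C_1, ← C_neg, ← C_pow, natDegree_C]
        omega
      · rw [abs_of_nonpos (by linarith [hx.2])]
        simp [← mul_pow]
    · refine key ((X - C (-1)) ^ r) hdeg dvd_rfl fun x hx => ?_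
      rw [abs_of_nonneg (by linarith [hx.1])]
      simp
  · refine ⟨C (h ^ (r % 2)) * (X - C y) ^ (2 * (r / 2)), ?_, fun x _ => ?_, dvd_mul_left _ _,
      fun h => absurd h hy⟩
    · refine (natDegree_C_mul_le _ _).trans ?_
      simpa using Nat.mul_div_le r 2
    · have e1 : eval x (C (h ^ (r % 2)) * (X - C y) ^ (2 * (r / 2))) =
          h ^ (r % 2) * |x - y| ^ (2 * (r / 2)) := by
        rw [(even_two_mul _).pow_abs]
        simp
      have e2 : ∀ z : ℝ, z ^ r = z ^ (r % 2) * z ^ (2 * (r / 2)) := by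
        intro z; rw [← pow_add, Nat.mod_add_div]
      have hu : 0 ≤ |x - y| / h := by positivity
      have hux : |x - y| ≤ h * (1 + |x - y| / h) := by
        rw [mul_add, mul_div_cancel₀ _ hh.ne']
        linarith
      rw [e1]
      refine ⟨by positivity, ?_, ?_⟩
      · have h1 : |x - y| ^ (r % 2) ≤ h ^ (r % 2) * (1 + |x - y| / h) := by
          rcases Nat.mod_two_eq_zero_or_one r with h0 | h0 <;> rw [h0]
          · simpa using hu
          · simpa using hux
        rw [e2]
        calc _ ≤ (h ^ (r % 2) * (1 + |x - y| / h)) * |x - y| ^ (2 * (r / 2)) := by gcongr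
          _ = _ := by ring
      · rw [← mul_pow, e2]
        refine mul_le_mul (pow_le_pow_left₀ hh.le ?_ _)
          (pow_le_pow_left₀ (abs_nonneg _) hux _) (by positivity) (by positivity)
        exact le_mul_of_one_le_right hh.le (by linarith)

/-- Local onesided approximation: near `y` at scale `h`, a polynomial of bounded degree lies above
`f`, interpolates `f` at `y`, and is close to `f` up to a factor growing polynomially in
`|x - y| / h`. -/
theorem exists_onesided_local {k : ℕ} (hk : 1 ≤ k) (r : ℕ) :
    ∃ A : ℝ, 0 ≤ A ∧ ∃ K M : ℕ, ∀ f : ℝ → ℝ, ContDiffOn ℝ r f (Icc (-1) 1) →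
      ∀ y ∈ Icc (-1 : ℝ) 1, ∀ h : ℝ, 0 < h → 2 * (k : ℝ) ^ 2 * h ≤ 1 →
      ∃ p : ℝ[X], p.natDegree ≤ K ∧ (∀ x ∈ Icc (-1 : ℝ) 1, f x ≤ p.eval x ∧
        p.eval x - f x ≤ A * (h ^ r * omegaK (iteratedDerivWithin r f (Icc (-1) 1)) k h (-1) 1 *
          (1 + |x - y| / h) ^ M)) ∧
        (∀ i < 2 * (r / 2),
          (derivative^[i] p).eval y = iteratedDerivWithin i f (Icc (-1) 1) y) ∧
        (y = 1 ∨ y = -1 → ∀ i < r,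
          (derivative^[i] p).eval y = iteratedDerivWithin i f (Icc (-1) 1) y) := by
  obtain ⟨A, hA, hW⟩ := exists_polynomial_whitney hk
  refine ⟨2 * (A * 2 ^ (k + 1)), by positivity, k + r + (r + (k + 1) * 2), r + 2 * (k + 1), ?_⟩
  intro f hf y hy h hh hkh
  set I := Icc (-1 : ℝ) 1
  have hI : UniqueDiffOn ℝ I := uniqueDiffOn_Icc (by norm_num)
  have hg : ContinuousOn (iteratedDerivWithin r f I) I :=
    hf.continuousOn_iteratedDerivWithin le_rfl hI
  obtain ⟨q, hqk, hq⟩ := hW _ hg y hy h hh hkh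
  set ω := omegaK (iteratedDerivWithin r f I) k h (-1) 1
  have hω : 0 ≤ ω := omegaK_nonneg _ _ _ _ _
  obtain ⟨p, hpq, hpv, hpd⟩ := exists_polynomial_iterate_derivative_eq q y r
    fun i => iteratedDerivWithin i f I y
  have hclose : ∀ x ∈ I, |f x - p.eval x| ≤ |x - y| ^ r * (A * (1 + |x - y| / h) ^ k * ω) := by
    intro x hx
    have := abs_le_of_hasDerivWithinAt_chain hy (B := fun t => A * (1 + max 0 t / h) ^ k * ω) ?_ r
      (fun i x => iteratedDerivWithin i f I x - (derivative^[i] p).eval x) ?_ ?_ ?_ x hx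
    · simpa using this
    · intro s t hst
      have : max 0 s ≤ max 0 t := max_le_max_left _ hst
      have h0 : 0 ≤ max 0 s := le_max_left _ _
      simp only
      gcongr
    · intro j hj z hz
      refine HasDerivWithinAt.sub ?_ ?_
      · rw [iteratedDerivWithin_succ]
        exact ((hf.differentiableOn_iteratedDerivWithin (by exact_mod_cast hj) hI) z
          hz).hasDerivWithinAt
      · rw [Function.iterate_succ_apply']
        exact ((derivative^[j] p).hasDerivAt z).hasDerivWithinAt
    · intro j hj
      simp [hpv j hj]
    · intro z hz
      simpa [hpq] using hq z hz
  obtain ⟨B, hBd, hB, hBdvd, hBdvd'⟩ := exists_nonneg_polynomial_vanishing r (y := y) hh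
  set E : ℝ[X] := B * (C (A * ω * 2 ^ (k + 1)) * (1 + (C h⁻¹ * (X - C y)) ^ 2) ^ (k + 1)) with hE
  have hEx : ∀ x, E.eval x =
      B.eval x * (A * ω * 2 ^ (k + 1) * (1 + (|x - y| / h) ^ 2) ^ (k + 1)) := by
    intro x
    rw [hE, div_pow, sq_abs]
    simp only [eval_mul, eval_C, eval_pow, eval_add, eval_one, eval_sub, eval_X]
    rw [mul_pow, inv_pow, div_eq_inv_mul]
  have hderiv : ∀ s ≤ r, (X - C y) ^ s ∣ B → ∀ i < s,
      (derivative^[i] (p + E)).eval y = iteratedDerivWithin i f I y := by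
    intro s hs hdvd i hi
    rw [iterate_map_add, eval_add, hpv i (by omega),
      eval_iterate_derivative_eq_zero_of_dvd (hdvd.mul_right _) hi, add_zero]
  refine ⟨p + E, ?_, fun x hx => ?_, hderiv _ (Nat.mul_div_le r 2) hBdvd,
    fun hy => hderiv r le_rfl (hBdvd' hy)⟩
  · have h1 : E.natDegree ≤ r + (k + 1) * 2 := by
      refine natDegree_mul_le.trans (add_le_add hBd ((natDegree_C_mul_le _ _).trans ?_))
      refine natDegree_pow_le.trans (Nat.mul_le_mul_left _ ?_)
      refine (natDegree_add_le _ _).trans (max_le (by simp) ?_)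
      refine natDegree_pow_le.trans ?_
      have : (C h⁻¹ * (X - C y)).natDegree ≤ 1 := (natDegree_C_mul_le _ _).trans (by simp)
      omega
    refine (natDegree_add_le _ _).trans (max_le ?_ ?_) <;> omega
  · obtain ⟨hB0, hB1, hB2⟩ := hB x hx
    set u := |x - y| / h with hu
    have hu0 : 0 ≤ u := by positivity
    have hsq : 1 + u ≤ 2 * (1 + u ^ 2) := by nlinarith [sq_nonneg (u - 1 / 2)]
    have hsq' : 1 + u ^ 2 ≤ (1 + u) ^ 2 := by nlinarith
    have hfE : |f x - p.eval x| ≤ E.eval x := by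
      refine (hclose x hx).trans ?_
      rw [hEx]
      calc _ ≤ (B.eval x * (1 + u)) * (A * (1 + u) ^ k * ω) := by gcongr
        _ = B.eval x * (A * ω * (1 + u) ^ (k + 1)) := by ring
        _ ≤ B.eval x * (A * ω * (2 * (1 + u ^ 2)) ^ (k + 1)) := by gcongr
        _ = _ := by rw [mul_pow]; ring
    have hEle : E.eval x ≤ A * 2 ^ (k + 1) * (h ^ r * ω * (1 + u) ^ (r + 2 * (k + 1))) := by
      rw [hEx]
      calc _ ≤ (h ^ r * (1 + u) ^ r) * (A * ω * 2 ^ (k + 1) * ((1 + u) ^ 2) ^ (k + 1)) := by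
            gcongr
        _ = _ := by rw [pow_add (1 + u) r, pow_mul]; ring
    rw [abs_le] at hfE
    rw [eval_add]
    constructor <;> linarith [hfE.1, hfE.2]

theorem sum_cos_grid {N : ℕ} {i : ℕ} (hi : 0 < i) (hiN : i < N) (θ : ℝ) :
    ∑ j ∈ Finset.range N, Real.cos (i * (θ + 2 * Real.pi * j / N)) = 0 := by
  have hN : N ≠ 0 := by omega
  have hζ := Complex.isPrimitiveRoot_exp N hN
  set ζ := Complex.exp (2 * Real.pi * Complex.I / N) with hζd
  have h1 : ζ ^ i ≠ 1 := hζ.pow_ne_one_of_pos_of_lt hi.ne' hiN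
  have h2 : ∑ j ∈ Finset.range N, (ζ ^ i) ^ j = 0 := by
    refine eq_zero_of_ne_zero_of_mul_left_eq_zero (sub_ne_zero_of_ne h1.symm) ?_
    rw [mul_neg_geom_sum, ← pow_mul, mul_comm, pow_mul, hζ.pow_eq_one, one_pow, sub_self]
  have h3 : ∀ j ∈ Finset.range N, Real.cos (i * (θ + 2 * Real.pi * j / N))
      = (Complex.exp ((i * θ : ℝ) * Complex.I) * (ζ ^ i) ^ j).re := by
    intro j _
    rw [← Complex.exp_ofReal_mul_I_re, hζd, ← Complex.exp_nat_mul, ← Complex.exp_nat_mul,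
      ← Complex.exp_add]
    congr 2
    push_cast
    have : (N : ℂ) ≠ 0 := by exact_mod_cast hN
    field_simp
  rw [Finset.sum_congr rfl h3, ← Complex.re_sum, ← Finset.mul_sum, h2]
  simp

theorem sum_chebyshevT_grid {N : ℕ} {i : ℕ} (hiN : i < N) (θ : ℝ) :
    ∑ j ∈ Finset.range N, (Chebyshev.T ℝ i).eval (Real.cos (θ + 2 * Real.pi * j / N))
      = if i = 0 then (N : ℝ) else 0 := by
  split_ifs with h
  · simp [h]
  · rw [← sum_cos_grid (Nat.pos_of_ne_zero h) hiN θ]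
    simp [Chebyshev.T_real_cos]

theorem sum_eval_grid_eq {N : ℕ} {Q : ℝ[X]} (hQ : Q.degree < N) (θ φ : ℝ) :
    ∑ j ∈ Finset.range N, Q.eval (Real.cos (θ + 2 * Real.pi * j / N))
      = ∑ j ∈ Finset.range N, Q.eval (Real.cos (φ + 2 * Real.pi * j / N)) := by
  have hmem : Q ∈ degreeLT ℝ N := by rwa [mem_degreeLT]
  rw [← Sequence.span_degreeLT (Chebyshev.chebyshevTsequence ℝ) (by simp),
    show Set.Iio N = Finset.range N by simp,
    Submodule.mem_span_image_finset_iff_exists_fun'] at hmem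
  obtain ⟨c, rfl⟩ := hmem
  simp_rw [eval_finsetSum, eval_smul]
  conv_lhs => rw [Finset.sum_comm]
  conv_rhs => rw [Finset.sum_comm]
  refine Finset.sum_congr rfl fun i hi => ?_
  rw [← Finset.smul_sum, ← Finset.smul_sum]
  congr 1
  have h := Finset.mem_range.1 hi
  exact (sum_chebyshevT_grid h θ).trans (sum_chebyshevT_grid h φ).symm

/-- The Dirichlet kernel `1 + 2 ∑_{l=1}^i T_l`. -/
noncomputable def dirichletPoly (i : ℕ) : ℝ[X] :=
  1 + 2 * ∑ l ∈ Finset.range i, Chebyshev.T ℝ (l + 1 : ℕ)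

/-- The Fejér kernel `m⁻² ∑_{i<m} D_i`, normalised to be `1` at `1`. -/
noncomputable def fejerPoly (m : ℕ) : ℝ[X] :=
  C (((m : ℝ) ^ 2)⁻¹) * ∑ i ∈ Finset.range m, dirichletPoly i

theorem one_sub_X_mul_dirichletPoly (i : ℕ) :
    (1 - X) * dirichletPoly i = Chebyshev.T ℝ i - Chebyshev.T ℝ (i + 1 : ℕ) := by
  induction i with
  | zero => simp [dirichletPoly]
  | succ i ih =>
    have h : dirichletPoly (i + 1) = dirichletPoly i + 2 * Chebyshev.T ℝ (i + 1 : ℕ) := by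
      simp only [dirichletPoly, Finset.sum_range_succ]; ring
    have h2 := Chebyshev.T_add_two ℝ (i : ℤ)
    rw [h, mul_add, ih]
    push_cast at h2 ⊢
    rw [show (i : ℤ) + 1 + 1 = i + 2 by ring, h2]
    ring

theorem one_sub_mul_fejerPoly {m : ℕ} (hm : 1 ≤ m) (z : ℝ) :
    (1 - z) * ((m : ℝ) ^ 2 * (fejerPoly m).eval z) = 1 - (Chebyshev.T ℝ m).eval z := by
  have h : (1 - X) * ∑ i ∈ Finset.range m, dirichletPoly i = 1 - Chebyshev.T ℝ m := by
    rw [Finset.mul_sum, Finset.sum_congr rfl fun i _ => one_sub_X_mul_dirichletPoly i,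
      Finset.sum_range_sub' fun i : ℕ => Chebyshev.T ℝ i]
    simp
  have h1 := congrArg (eval z) h
  simp only [eval_mul, eval_sub, eval_one, eval_X] at h1
  have hm' : (m : ℝ) ≠ 0 := by positivity
  rw [← h1, fejerPoly, eval_mul, eval_C, mul_inv_cancel_left₀ (by positivity)]

theorem abs_chebyshevT_le_one (m : ℤ) {z : ℝ} (hz : z ∈ Icc (-1 : ℝ) 1) :
    |(Chebyshev.T ℝ m).eval z| ≤ 1 := by
  rw [← Real.cos_arccos hz.1 hz.2, Chebyshev.T_real_cos]
  exact Real.abs_cos_le_one _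

theorem natDegree_fejerPoly_le (m : ℕ) : (fejerPoly m).natDegree ≤ m - 1 := by
  refine (natDegree_C_mul_le _ _).trans (natDegree_sum_le_of_forall_le _ _ fun i hi => ?_)
  have hi := Finset.mem_range.1 hi
  refine (natDegree_add_le _ _).trans (max_le (by simp) ?_)
  rw [← map_ofNat C 2]
  refine (natDegree_C_mul_le _ _).trans (natDegree_sum_le_of_forall_le _ _ fun l hl => ?_)
  have hl := Finset.mem_range.1 hl
  rw [Chebyshev.natDegree_T, Int.natAbs_natCast]
  omega

theorem sum_two_mul_add_one (m : ℕ) : ∑ i ∈ Finset.range m, (2 * (i : ℝ) + 1) = (m : ℝ) ^ 2 := by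
  induction m with
  | zero => simp
  | succ m ih => rw [Finset.sum_range_succ, ih]; push_cast; ring

theorem eval_dirichletPoly (i : ℕ) (z : ℝ) : (dirichletPoly i).eval z =
    1 + 2 * ∑ l ∈ Finset.range i, (Chebyshev.T ℝ (l + 1 : ℕ)).eval z := by
  simp [dirichletPoly, eval_finsetSum]

theorem eval_fejerPoly (m : ℕ) (z : ℝ) : (fejerPoly m).eval z =
    ((m : ℝ) ^ 2)⁻¹ * ∑ i ∈ Finset.range m, (dirichletPoly i).eval z := by
  simp [fejerPoly, eval_finsetSum]

theorem fejerPoly_eval_one {m : ℕ} (hm : 1 ≤ m) : (fejerPoly m).eval 1 = 1 := by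
  have h (i : ℕ) : (dirichletPoly i).eval 1 = 2 * (i : ℝ) + 1 := by
    simp [eval_dirichletPoly, add_comm]
  have hm' : (m : ℝ) ≠ 0 := by positivity
  simp [eval_fejerPoly, h, sum_two_mul_add_one, hm']

theorem fejerPoly_le_one {m : ℕ} (hm : 1 ≤ m) {z : ℝ} (hz : z ∈ Icc (-1 : ℝ) 1) :
    (fejerPoly m).eval z ≤ 1 := by
  rw [eval_fejerPoly, inv_mul_le_iff₀ (by positivity), mul_one, ← sum_two_mul_add_one]
  refine Finset.sum_le_sum fun i _ => ?_
  have h : ∑ l ∈ Finset.range i, (Chebyshev.T ℝ (l + 1 : ℕ)).eval z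
      ≤ ∑ l ∈ Finset.range i, (1 : ℝ) :=
    Finset.sum_le_sum fun l _ => (abs_le.1 (abs_chebyshevT_le_one _ hz)).2
  rw [eval_dirichletPoly]
  simp only [Finset.sum_const, Finset.card_range, nsmul_eq_mul, mul_one] at h
  linarith

theorem fejerPoly_nonneg {m : ℕ} (hm : 1 ≤ m) {z : ℝ} (hz : z ∈ Icc (-1 : ℝ) 1) :
    0 ≤ (fejerPoly m).eval z := by
  rcases eq_or_lt_of_le hz.2 with rfl | h
  · simp [fejerPoly_eval_one hm]
  · have h1 := one_sub_mul_fejerPoly hm z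
    have h2 := (abs_le.1 (abs_chebyshevT_le_one m hz)).2
    have hm' : (0 : ℝ) < m := by exact_mod_cast hm
    by_contra! h3
    have : (1 - z) * ((m : ℝ) ^ 2 * (fejerPoly m).eval z) < 0 :=
      mul_neg_of_pos_of_neg (by linarith) (mul_neg_of_pos_of_neg (by positivity) h3)
    linarith

theorem one_sub_mul_fejerPoly_le {m : ℕ} (hm : 1 ≤ m) {z : ℝ} (hz : z ∈ Icc (-1 : ℝ) 1) :
    (1 - z) * ((m : ℝ) ^ 2 * (fejerPoly m).eval z) ≤ 2 := by
  rw [one_sub_mul_fejerPoly hm]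
  linarith [(abs_le.1 (abs_chebyshevT_le_one m hz)).1]

theorem sum_fejerPoly_grid {m N : ℕ} (hm : 1 ≤ m) (hmN : m ≤ N) (θ : ℝ) :
    ∑ j ∈ Finset.range N, (fejerPoly m).eval (Real.cos (θ + 2 * Real.pi * j / N)) = N / m := by
  have h : ∀ i ∈ Finset.range m, ∑ j ∈ Finset.range N,
      (dirichletPoly i).eval (Real.cos (θ + 2 * Real.pi * j / N)) = N := by
    intro i hi
    have hi := Finset.mem_range.1 hi
    simp_rw [eval_dirichletPoly]
    rw [Finset.sum_add_distrib, ← Finset.mul_sum, Finset.sum_comm,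
      Finset.sum_eq_zero (s := Finset.range i)]
    · simp
    · intro l hl
      have hl := Finset.mem_range.1 hl
      rw [sum_chebyshevT_grid (by omega), if_neg (by omega)]
  simp_rw [eval_fejerPoly]
  rw [← Finset.mul_sum, Finset.sum_comm, Finset.sum_congr rfl h]
  have hm' : (m : ℝ) ≠ 0 := by positivity
  simp only [Finset.sum_const, Finset.card_range, nsmul_eq_mul]
  field_simp

/-- The symmetrised translate of a polynomial in the variable `x = cos θ`. -/
theorem exists_polynomial_symm (Q : ℝ[X]) {y : ℝ} (hy : y ∈ Icc (-1 : ℝ) 1) :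
    ∃ V : ℝ[X], V.natDegree ≤ Q.natDegree ∧ ∀ x ∈ Icc (-1 : ℝ) 1,
      V.eval x = Q.eval (x * y + √(1 - x ^ 2) * √(1 - y ^ 2))
        + Q.eval (x * y - √(1 - x ^ 2) * √(1 - y ^ 2)) := by
  have hmon : ∀ i : ℕ, (∃ V : ℝ[X], V.natDegree ≤ i ∧ ∀ x ∈ Icc (-1 : ℝ) 1,
      V.eval x = (x * y + √(1 - x ^ 2) * √(1 - y ^ 2)) ^ i
        + (x * y - √(1 - x ^ 2) * √(1 - y ^ 2)) ^ i) := by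
    intro i
    induction i using Nat.twoStepInduction with
    | zero => exact ⟨2, by simp, fun x _ => by simp; norm_num⟩
    | one =>
      refine ⟨C (2 * y) * X, (natDegree_C_mul_le _ _).trans (by simp), fun x _ => ?_⟩
      simp only [eval_mul, eval_C, eval_X]
      ring
    | more i h0 h1 =>
      obtain ⟨V, hV, hVe⟩ := h0
      obtain ⟨W, hW, hWe⟩ := h1
      refine ⟨C (2 * y) * X * W - (X ^ 2 + C (y ^ 2 - 1)) * V, ?_, fun x hx => ?_⟩
      · refine (natDegree_sub_le _ _).trans (max_le ?_ ?_)
        · refine natDegree_mul_le.trans ?_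
          have : (C (2 * y) * X).natDegree ≤ 1 := (natDegree_C_mul_le _ _).trans (by simp)
          omega
        · refine natDegree_mul_le.trans ?_
          have : (X ^ 2 + C (y ^ 2 - 1)).natDegree ≤ 2 :=
            (natDegree_add_le _ _).trans (max_le (natDegree_X_pow_le 2) ((natDegree_C _).trans_le zero_le_two))
          omega
      · simp only [eval_sub, eval_mul, eval_C, eval_X, eval_add, eval_pow, hVe x hx, hWe x hx]
        have hs : √(1 - x ^ 2) ^ 2 = 1 - x ^ 2 := Real.sq_sqrt (by nlinarith [hx.1, hx.2])
        have ht : √(1 - y ^ 2) ^ 2 = 1 - y ^ 2 := Real.sq_sqrt (by nlinarith [hy.1, hy.2])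
        have hv : (√(1 - x ^ 2) * √(1 - y ^ 2)) ^ 2 = (1 - x ^ 2) * (1 - y ^ 2) := by
          rw [mul_pow, hs, ht]
        set v := √(1 - x ^ 2) * √(1 - y ^ 2)
        rw [show x ^ 2 + (y ^ 2 - 1) = (x * y) ^ 2 - v ^ 2 by rw [hv]; ring]
        ring
  choose V hV hVe using hmon
  refine ⟨∑ i ∈ Finset.range (Q.natDegree + 1), C (Q.coeff i) * V i, ?_, fun x hx => ?_⟩
  · refine natDegree_sum_le_of_forall_le _ _ fun i hi => (natDegree_C_mul_le _ _).trans ?_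
    have hi := Finset.mem_range.1 hi
    exact (hV i).trans (by omega)
  · rw [eval_finsetSum, eval_eq_sum_range, eval_eq_sum_range, ← Finset.sum_add_distrib]
    exact Finset.sum_congr rfl fun i _ => by rw [eval_mul, eval_C, hVe i x hx, mul_add]

/-- Half the chord between the points of the upper unit semicircle over `x` and `y`. -/
noncomputable def chordDist (x y : ℝ) : ℝ :=
  √((x - y) ^ 2 + (√(1 - x ^ 2) - √(1 - y ^ 2)) ^ 2) / 2

theorem chordDist_nonneg (x y : ℝ) : 0 ≤ chordDist x y := by
  unfold chordDist; positivity

theorem sq_sqrt_one_sub_sq {x : ℝ} (hx : x ∈ Icc (-1 : ℝ) 1) : √(1 - x ^ 2) ^ 2 = 1 - x ^ 2 :=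
  Real.sq_sqrt (by nlinarith [hx.1, hx.2])

theorem four_mul_chordDist_sq (x y : ℝ) :
    4 * chordDist x y ^ 2 = (x - y) ^ 2 + (√(1 - x ^ 2) - √(1 - y ^ 2)) ^ 2 := by
  rw [chordDist, div_pow, Real.sq_sqrt (by positivity)]
  ring

theorem two_mul_chordDist_sq {x y : ℝ} (hx : x ∈ Icc (-1 : ℝ) 1) (hy : y ∈ Icc (-1 : ℝ) 1) :
    2 * chordDist x y ^ 2 = 1 - (x * y + √(1 - x ^ 2) * √(1 - y ^ 2)) := by
  linarith [four_mul_chordDist_sq x y, sq_sqrt_one_sub_sq hx, sq_sqrt_one_sub_sq hy]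

theorem abs_sub_le_two_mul_chordDist (x y : ℝ) : |x - y| ≤ 2 * chordDist x y := by
  refine abs_le_of_sq_le_sq ?_ (by linarith [chordDist_nonneg x y])
  nlinarith [four_mul_chordDist_sq x y, sq_nonneg (√(1 - x ^ 2) - √(1 - y ^ 2))]

theorem abs_sqrt_sub_le_two_mul_chordDist (x y : ℝ) :
    |√(1 - x ^ 2) - √(1 - y ^ 2)| ≤ 2 * chordDist x y := by
  refine abs_le_of_sq_le_sq ?_ (by linarith [chordDist_nonneg x y])
  nlinarith [four_mul_chordDist_sq x y, sq_nonneg (x - y)]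

theorem abs_sub_le_chordDist_mul {x y : ℝ} (hx : x ∈ Icc (-1 : ℝ) 1) (hy : y ∈ Icc (-1 : ℝ) 1) :
    |x - y| ≤ 2 * chordDist x y * (√(1 - y ^ 2) + chordDist x y) := by
  have h0 := chordDist_nonneg x y
  have h1 := two_mul_chordDist_sq hx hy
  have hs := sq_sqrt_one_sub_sq hx
  have ht := sq_sqrt_one_sub_sq hy
  have hd := (abs_le.1 (abs_sqrt_sub_le_two_mul_chordDist x y)).2
  have hs0 := Real.sqrt_nonneg (1 - x ^ 2)
  have ht0 := Real.sqrt_nonneg (1 - y ^ 2)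
  set s := √(1 - x ^ 2)
  set t := √(1 - y ^ 2)
  set d := chordDist x y
  refine abs_le_of_sq_le_sq ?_ (by positivity)
  have h2 : (x - y) ^ 2 = (2 * d ^ 2) * (2 * d ^ 2 + 2 * (s * t)) := by
    have h3 : (s * t) ^ 2 = (1 - x ^ 2) * (1 - y ^ 2) := by rw [mul_pow, hs, ht]
    rw [h1]
    linear_combination h3
  have h4 : d ^ 2 + s * t ≤ (t + d) ^ 2 := by nlinarith
  calc (x - y) ^ 2 = 4 * d ^ 2 * (d ^ 2 + s * t) := by rw [h2]; ring
    _ ≤ 4 * d ^ 2 * (t + d) ^ 2 := by gcongr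
    _ = _ := by ring

theorem mul_add_sqrt_mem_Icc {x y : ℝ} (hx : x ∈ Icc (-1 : ℝ) 1) (hy : y ∈ Icc (-1 : ℝ) 1) :
    x * y + √(1 - x ^ 2) * √(1 - y ^ 2) ∈ Icc (-1 : ℝ) 1 := by
  have hs := sq_sqrt_one_sub_sq hx
  have ht := sq_sqrt_one_sub_sq hy
  constructor
  · nlinarith [sq_nonneg (x + y), sq_nonneg (√(1 - x ^ 2) + √(1 - y ^ 2))]
  · nlinarith [sq_nonneg (x - y), sq_nonneg (√(1 - x ^ 2) - √(1 - y ^ 2))]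

theorem mul_sub_sqrt_mem_Icc {x y : ℝ} (hx : x ∈ Icc (-1 : ℝ) 1) (hy : y ∈ Icc (-1 : ℝ) 1) :
    x * y - √(1 - x ^ 2) * √(1 - y ^ 2) ∈ Icc (-1 : ℝ) 1 := by
  have hs := sq_sqrt_one_sub_sq hx
  have ht := sq_sqrt_one_sub_sq hy
  constructor
  · nlinarith [sq_nonneg (x + y), sq_nonneg (√(1 - x ^ 2) - √(1 - y ^ 2))]
  · nlinarith [sq_nonneg (x - y), sq_nonneg (√(1 - x ^ 2) + √(1 - y ^ 2))]

theorem rho_pos {m : ℕ} (hm : 1 ≤ m) (x : ℝ) : 0 < rho m x := by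
  have : (0 : ℝ) < m := by exact_mod_cast hm
  unfold rho
  positivity

theorem rho_le_mul_rho {m : ℕ} (hm : 1 ≤ m) (x y : ℝ) :
    rho m y ≤ (1 + 2 * (m * chordDist x y)) * rho m x := by
  have hm' : (0 : ℝ) < m := by exact_mod_cast hm
  have hd := (abs_le.1 (abs_sqrt_sub_le_two_mul_chordDist x y)).1
  have hd0 := chordDist_nonneg x y
  have h1 : 1 / (m : ℝ) ^ 2 ≤ rho m x := le_add_of_nonneg_left (by positivity)
  have h2 : rho m y ≤ rho m x + 2 * (m * chordDist x y) * (1 / (m : ℝ) ^ 2) := by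
    unfold rho
    have : √(1 - y ^ 2) / m ≤ (√(1 - x ^ 2) + 2 * chordDist x y) / m := by gcongr; linarith
    calc _ ≤ (√(1 - x ^ 2) + 2 * chordDist x y) / m + 1 / (m : ℝ) ^ 2 := by gcongr
      _ = _ := by field_simp; ring
  have h3 : 2 * (m * chordDist x y) * (1 / (m : ℝ) ^ 2) ≤ 2 * (m * chordDist x y) * rho m x := by
    gcongr
  linarith

theorem abs_sub_le_mul_rho {m : ℕ} (hm : 1 ≤ m) {x y : ℝ} (hx : x ∈ Icc (-1 : ℝ) 1)
    (hy : y ∈ Icc (-1 : ℝ) 1) :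
    |x - y| ≤ 2 * (m * chordDist x y) * (1 + m * chordDist x y) * rho m y := by
  have hm' : (0 : ℝ) < m := by exact_mod_cast hm
  have hd0 := chordDist_nonneg x y
  have ht0 := Real.sqrt_nonneg (1 - y ^ 2)
  refine (abs_sub_le_chordDist_mul hx hy).trans ?_
  have h : 2 * (m * chordDist x y) * (1 + m * chordDist x y) * rho m y =
      2 * chordDist x y * (√(1 - y ^ 2) + chordDist x y
        + (m * chordDist x y * √(1 - y ^ 2) + 1 / m)) := by
    unfold rho
    field_simp
    ring
  rw [h]
  have h0 : (0 : ℝ) ≤ m * chordDist x y * √(1 - y ^ 2) + 1 / m := by positivity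
  exact mul_le_mul_of_nonneg_left (by linarith) (by positivity)

theorem one_add_sq_mul_fejerPoly_le {m : ℕ} (hm : 1 ≤ m) {z d : ℝ} (hz : z ∈ Icc (-1 : ℝ) 1)
    (hd : 2 * d ^ 2 ≤ 1 - z) : (1 + m * d) ^ 2 * (fejerPoly m).eval z ≤ 4 := by
  have h0 := fejerPoly_nonneg hm hz
  have h1 := fejerPoly_le_one hm hz
  have h2 := one_sub_mul_fejerPoly_le hm hz
  have h3 : (2 * d ^ 2) * ((m : ℝ) ^ 2 * (fejerPoly m).eval z) ≤ 2 :=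
    (mul_le_mul_of_nonneg_right hd (by positivity)).trans h2
  have h4 : (1 + m * d) ^ 2 ≤ 2 + 2 * (m * d) ^ 2 := by nlinarith [sq_nonneg (1 - m * d)]
  calc _ ≤ (2 + 2 * (m * d) ^ 2) * (fejerPoly m).eval z := by gcongr
    _ = 2 * (fejerPoly m).eval z + (2 * d ^ 2) * ((m : ℝ) ^ 2 * (fejerPoly m).eval z) := by ring
    _ ≤ 4 := by linarith

theorem one_add_pow_mul_fejerPoly_pow_le {m : ℕ} (hm : 1 ≤ m) {z d : ℝ} (hz : z ∈ Icc (-1 : ℝ) 1)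
    (hd : 2 * d ^ 2 ≤ 1 - z) (s : ℕ) :
    (1 + m * d) ^ (2 * s) * (fejerPoly m).eval z ^ s ≤ 4 ^ s := by
  rw [pow_mul, ← mul_pow]
  exact pow_le_pow_left₀ (mul_nonneg (sq_nonneg _) (fejerPoly_nonneg hm hz))
    (one_add_sq_mul_fejerPoly_le hm hz hd) s

theorem chordDist_sq_le_sub {x y : ℝ} (hx : x ∈ Icc (-1 : ℝ) 1) (hy : y ∈ Icc (-1 : ℝ) 1) :
    2 * chordDist x y ^ 2 ≤ 1 - (x * y - √(1 - x ^ 2) * √(1 - y ^ 2)) := by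
  have : 0 ≤ √(1 - x ^ 2) * √(1 - y ^ 2) := by positivity
  linarith [two_mul_chordDist_sq hx hy]

theorem exists_partition_of_unity (M : ℕ) {m : ℕ} (hm : 1 ≤ m) :
    ∃ (ι : Type) (_ : Fintype ι) (w : ι → ℝ[X]) (c : ι → ℝ), (∀ i, c i ∈ Icc (-1 : ℝ) 1) ∧
      ∑ i, w i = 1 ∧ (∀ i, ∀ x ∈ Icc (-1 : ℝ) 1, 0 ≤ (w i).eval x) ∧
      (∀ i, (w i).natDegree ≤ (M + 1) * m) ∧
      ∀ x ∈ Icc (-1 : ℝ) 1,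
        ∑ i, (w i).eval x * (1 + m * chordDist x (c i)) ^ (2 * M) ≤ 4 ^ M * (M + 1) := by
  set N := (M + 1) * m with hN
  have hm0 : (0 : ℝ) < m := by exact_mod_cast hm
  have hmN : m ≤ N := Nat.le_mul_of_pos_left _ (Nat.succ_pos _)
  let y : ℕ → ℝ := fun j => Real.cos (2 * Real.pi * j / N)
  have hy : ∀ j, y j ∈ Icc (-1 : ℝ) 1 := fun j => ⟨Real.neg_one_le_cos _, Real.cos_le_one _⟩
  have hgrid : ∀ (Q : ℝ[X]) (x : ℝ), x ∈ Icc (-1 : ℝ) 1 → ∀ j,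
      Q.eval (x * y j + √(1 - x ^ 2) * √(1 - y j ^ 2))
        + Q.eval (x * y j - √(1 - x ^ 2) * √(1 - y j ^ 2))
      = Q.eval (Real.cos (Real.arccos x + 2 * Real.pi * j / N))
        + Q.eval (Real.cos (-Real.arccos x + 2 * Real.pi * j / N)) := by
    intro Q x hx j
    set τ := 2 * Real.pi * j / N with hτ
    have h1 : √(1 - y j ^ 2) = |Real.sin τ| := by
      rw [← Real.sqrt_sq_eq_abs, Real.sin_sq]
    rw [h1, Real.cos_add, Real.cos_add, Real.cos_neg, Real.sin_neg, Real.cos_arccos hx.1 hx.2,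
      Real.sin_arccos]
    have hyj : y j = Real.cos τ := rfl
    rw [hyj]
    rcases abs_cases (Real.sin τ) with h | h <;> rw [h.1]
    · rw [add_comm]
      congr 2; ring
    · congr 2 <;> ring
  have hdeg : (fejerPoly m ^ (M + 1)).natDegree < N := by
    refine (natDegree_pow_le.trans (Nat.mul_le_mul_left _ (natDegree_fejerPoly_le m))).trans_lt ?_
    exact Nat.mul_lt_mul_of_pos_left (by omega) (Nat.succ_pos _)
  have hdeg' : (fejerPoly m ^ (M + 1)).degree < N :=
    degree_le_natDegree.trans_lt (by exact_mod_cast hdeg)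
  set S := ∑ j ∈ Finset.range N,
    (fejerPoly m ^ (M + 1)).eval (Real.cos (0 + 2 * Real.pi * j / N)) with hS
  have hS1 : 1 ≤ S := by
    have h := Finset.single_le_sum (f := fun j : ℕ =>
      (fejerPoly m ^ (M + 1)).eval (Real.cos (0 + 2 * Real.pi * j / N))) (s := Finset.range N)
      (fun j _ => ?_) (Finset.mem_range.2 (show 0 < N by omega))
    · simpa [hS, fejerPoly_eval_one hm] using h
    · rw [eval_pow]
      exact pow_nonneg (fejerPoly_nonneg hm ⟨Real.neg_one_le_cos _, Real.cos_le_one _⟩) _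
  choose V hVd hV using fun j => exists_polynomial_symm (fejerPoly m ^ (M + 1)) (hy j)
  have hpos : ∀ j, ∀ x ∈ Icc (-1 : ℝ) 1, 0 ≤ (V j).eval x := by
    intro j x hx
    rw [hV j x hx, eval_pow, eval_pow]
    exact add_nonneg (pow_nonneg (fejerPoly_nonneg hm (mul_add_sqrt_mem_Icc hx (hy j))) _)
      (pow_nonneg (fejerPoly_nonneg hm (mul_sub_sqrt_mem_Icc hx (hy j))) _)
  refine ⟨Fin N, inferInstance, fun j => C (2 * S)⁻¹ * V j, fun j => y j, fun j => hy j, ?_,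
    fun j x hx => ?_, fun j => ?_, fun x hx => ?_⟩
  · refine eq_of_infinite_eval_eq _ _ ((Icc_infinite (show (-1 : ℝ) < 1 by norm_num)).mono ?_)
    intro x hx
    simp only [mem_ofPred_eq, eval_finsetSum, eval_mul, eval_C, eval_one]
    rw [← Finset.mul_sum, Fin.sum_univ_eq_sum_range (fun j => (V j).eval x),
      Finset.sum_congr rfl fun j _ => (hV j x hx).trans (hgrid _ x hx j), Finset.sum_add_distrib,
      sum_eval_grid_eq hdeg' _ 0, sum_eval_grid_eq hdeg' (-Real.arccos x) 0, ← hS]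
    field_simp
    norm_num
  · rw [eval_mul, eval_C]
    exact mul_nonneg (by positivity) (hpos j x hx)
  · exact (natDegree_C_mul_le _ _).trans ((hVd j).trans hdeg.le)
  · have hterm : ∀ j : ℕ, (V j).eval x * (1 + m * chordDist x (y j)) ^ (2 * M) ≤ 4 ^ M *
        ((fejerPoly m).eval (Real.cos (Real.arccos x + 2 * Real.pi * j / N))
        + (fejerPoly m).eval (Real.cos (-Real.arccos x + 2 * Real.pi * j / N))) := by
      intro j
      have h1 := one_add_pow_mul_fejerPoly_pow_le hm (mul_add_sqrt_mem_Icc hx (hy j))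
        (two_mul_chordDist_sq hx (hy j)).le M
      have h2 := one_add_pow_mul_fejerPoly_pow_le hm (mul_sub_sqrt_mem_Icc hx (hy j))
        (chordDist_sq_le_sub hx (hy j)) M
      have h3 := fejerPoly_nonneg hm (mul_add_sqrt_mem_Icc hx (hy j))
      have h4 := fejerPoly_nonneg hm (mul_sub_sqrt_mem_Icc hx (hy j))
      rw [← hgrid _ x hx j, hV j x hx, eval_pow, eval_pow]
      have h5 := mul_le_mul_of_nonneg_right h1 h3
      have h6 := mul_le_mul_of_nonneg_right h2 h4
      rw [pow_succ _ M, pow_succ _ M]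
      linarith
    have hsum : ∑ j ∈ Finset.range N, (V j).eval x * (1 + m * chordDist x (y j)) ^ (2 * M)
        ≤ 4 ^ M * (2 * (M + 1)) := by
      refine (Finset.sum_le_sum fun j _ => hterm j).trans_eq ?_
      rw [← Finset.mul_sum, Finset.sum_add_distrib, sum_fejerPoly_grid hm hmN,
        sum_fejerPoly_grid hm hmN, hN]
      push_cast
      field_simp
      norm_num
    simp only [eval_mul, eval_C, mul_assoc]
    rw [← Finset.mul_sum, Fin.sum_univ_eq_sum_range
      (fun j => (V j).eval x * (1 + m * chordDist x (y j)) ^ (2 * M)),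
      inv_mul_le_iff₀ (by positivity)]
    refine hsum.trans ?_
    have : (0 : ℝ) ≤ 4 ^ M * (M + 1) := by positivity
    nlinarith

theorem exists_peaking_polynomial (N : ℕ) (hN : 1 ≤ N) (U : ℝ[X]) :
    ∃ F : ℝ[X], F.natDegree ≤ (N + 1) * U.natDegree ∧ U ∣ F ∧
      (∀ x, U.eval x = 1 → F.eval x = 1) ∧
      ∀ x, 0 ≤ U.eval x → U.eval x ≤ N →
        0 ≤ F.eval x ∧ F.eval x ≤ 1 ∧ F.eval x ≤ 3 * U.eval x := by
  have hN0 : (0 : ℝ) < N := by exact_mod_cast hN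
  have heval : ∀ x, (U * (1 + C (N : ℝ)⁻¹ * (1 - U)) ^ N).eval x =
      U.eval x * (1 + (N : ℝ)⁻¹ * (1 - U.eval x)) ^ N := fun x => by simp
  refine ⟨U * (1 + C (N : ℝ)⁻¹ * (1 - U)) ^ N, ?_, dvd_mul_right _ _, fun x hx => ?_,
    fun x h0 h1 => ?_⟩
  · have h : (1 + C (N : ℝ)⁻¹ * (1 - U)).natDegree ≤ U.natDegree :=
      (natDegree_add_le _ _).trans (max_le (by simp) ((natDegree_C_mul_le _ _).trans
        ((natDegree_sub_le _ _).trans (max_le (by simp) le_rfl))))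
    calc _ ≤ U.natDegree + N * U.natDegree :=
          natDegree_mul_le.trans (add_le_add le_rfl (natDegree_pow_le.trans (by gcongr)))
      _ = _ := by ring
  · simp [hx]
  · rw [heval]
    set u := U.eval x
    have hb : 0 ≤ 1 + (N : ℝ)⁻¹ * (1 - u) := by
      have : 1 + (N : ℝ)⁻¹ * (1 - u) = (N : ℝ)⁻¹ * (N + 1 - u) := by field_simp; ring
      rw [this]
      exact mul_nonneg (by positivity) (by linarith)
    have hexp : (1 + (N : ℝ)⁻¹ * (1 - u)) ^ N ≤ Real.exp (1 - u) := by
      calc _ ≤ Real.exp ((N : ℝ)⁻¹ * (1 - u)) ^ N := by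
            gcongr
            linarith [Real.add_one_le_exp ((N : ℝ)⁻¹ * (1 - u))]
        _ = _ := by
            rw [← Real.exp_nat_mul]
            congr 1
            field_simp
    refine ⟨mul_nonneg h0 (pow_nonneg hb _), ?_, ?_⟩
    · calc _ ≤ Real.exp (u - 1) * Real.exp (1 - u) := by
            gcongr
            linarith [Real.add_one_le_exp (u - 1)]
        _ = 1 := by rw [← Real.exp_add]; simp
    · rw [mul_comm]
      gcongr
      refine hexp.trans ((Real.exp_le_exp.2 (show 1 - u ≤ 1 by linarith)).trans ?_)
      linarith [Real.exp_one_lt_d9]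

theorem exists_node_polynomial (M q r : ℕ) : ∃ C0 : ℝ, 0 ≤ C0 ∧ ∃ L : ℕ,
    ∀ Z : Finset ℝ, Z.card ≤ q → (∀ a ∈ Z, a ∈ Icc (-1 : ℝ) 1) → ∀ m : ℕ, 1 ≤ m →
      (∀ a ∈ Z, ∀ b ∈ Z, a ≠ b → 2 / (m : ℝ) ≤ |a - b|) → ∀ a ∈ Z,
      ∃ S : ℝ[X], S.natDegree ≤ L * m ∧ (X - C a) ^ r ∣ 1 - S ∧
        (∀ b ∈ Z, b ≠ a → (X - C b) ^ r ∣ S) ∧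
        ∀ x ∈ Icc (-1 : ℝ) 1, 0 ≤ S.eval x ∧ S.eval x ≤ 1 ∧
          S.eval x * (1 + m * chordDist x a) ^ (2 * M) ≤ C0 := by
  set s := M + r * q with hs
  set N := 2 * 4 ^ s with hN
  have hN1 : 1 ≤ N := Nat.one_le_iff_ne_zero.2 (by positivity)
  refine ⟨r * (3 * N), by positivity, r * ((N + 1) * (s + 2 * r * q)), ?_⟩
  intro Z hZ hZI m hm hsep a ha
  have hm0 : (0 : ℝ) < m := by exact_mod_cast hm
  have haI := hZI a ha
  obtain ⟨V, hVd, hV⟩ := exists_polynomial_symm (fejerPoly m ^ s) haI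
  set v := V.eval a with hv
  have hv1 : 1 ≤ v := by
    rw [hv, hV a haI, eval_pow, eval_pow]
    have h1 : a * a + √(1 - a ^ 2) * √(1 - a ^ 2) = 1 := by
      rw [← pow_two √(1 - a ^ 2), sq_sqrt_one_sub_sq haI]; ring
    rw [h1, fejerPoly_eval_one hm, one_pow]
    exact le_add_of_nonneg_right (pow_nonneg (fejerPoly_nonneg hm (mul_sub_sqrt_mem_Icc haI haI)) _)
  let R : ℝ[X] := ∏ b ∈ Z.erase a, (C (a - b)⁻¹ * (X - C b)) ^ (2 * r)
  have hRx : ∀ x, R.eval x = ∏ b ∈ Z.erase a, ((a - b)⁻¹ * (x - b)) ^ (2 * r) := fun x => by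
    simp [R, eval_prod]
  have hR0 : ∀ x, 0 ≤ R.eval x := fun x => by
    rw [hRx]
    exact Finset.prod_nonneg fun b _ => (even_two_mul r).pow_nonneg _
  have hcard : (Z.erase a).card ≤ q := (Finset.card_le_card (Finset.erase_subset _ _)).trans hZ
  have hR1 : ∀ x, R.eval x ≤ (1 + m * chordDist x a) ^ (2 * (r * q)) := fun x => by
    have hd := chordDist_nonneg x a
    rw [hRx]
    calc _ ≤ ∏ b ∈ Z.erase a, (1 + m * chordDist x a) ^ (2 * r) := by
          refine Finset.prod_le_prod (fun b _ => (even_two_mul r).pow_nonneg _) fun b hb => ?_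
          rw [← (even_two_mul r).pow_abs]
          refine pow_le_pow_left₀ (abs_nonneg _) ?_ _
          obtain ⟨hba, hbZ⟩ := Finset.mem_erase.1 hb
          have h1 := hsep a ha b hbZ hba.symm
          have hpos : 0 < |a - b| := abs_pos.2 (sub_ne_zero.2 hba.symm)
          rw [abs_mul, abs_inv, inv_mul_le_iff₀ hpos]
          have h2 : |x - b| ≤ |x - a| + |a - b| := abs_sub_le _ _ _
          have h3 := abs_sub_le_two_mul_chordDist x a
          have h4 : 2 * chordDist x a = 2 / m * (m * chordDist x a) := by field_simp
          have h5 : 2 / m * (m * chordDist x a) ≤ |a - b| * (m * chordDist x a) := by gcongr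
          linarith
      _ = ((1 + m * chordDist x a) ^ (2 * r)) ^ (Z.erase a).card := by
          rw [Finset.prod_const]
      _ ≤ ((1 + m * chordDist x a) ^ (2 * r)) ^ q := by
          refine pow_le_pow_right₀ (one_le_pow₀ ?_) hcard
          exact le_add_of_nonneg_right (by positivity)
      _ = _ := by rw [← pow_mul]; ring
  have hRa : R.eval a = 1 := by
    rw [hRx]
    refine Finset.prod_eq_one fun b hb => ?_
    rw [inv_mul_cancel₀ (sub_ne_zero.2 (Finset.ne_of_mem_erase hb).symm), one_pow]
  have hRd : R.natDegree ≤ 2 * r * q := by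
    refine (natDegree_prod_le _ _).trans ?_
    calc _ ≤ ∑ b ∈ Z.erase a, 2 * r * 1 := by
          refine Finset.sum_le_sum fun b _ => natDegree_pow_le.trans (Nat.mul_le_mul_left _ ?_)
          exact (natDegree_C_mul_le _ _).trans (by simp)
      _ ≤ 2 * r * q := by
          rw [Finset.sum_const, smul_eq_mul, mul_one, mul_comm]
          gcongr
  have hRdvd : ∀ b ∈ Z, b ≠ a → (X - C b) ^ r ∣ R := by
    intro b hb hba
    refine Dvd.dvd.trans ?_ (Finset.dvd_prod_of_mem _ (Finset.mem_erase.2 ⟨hba, hb⟩))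
    rw [mul_pow]
    exact Dvd.dvd.mul_left (pow_dvd_pow _ (by omega)) _
  set U : ℝ[X] := C v⁻¹ * V * R with hU
  have hUx : ∀ x, U.eval x = v⁻¹ * V.eval x * R.eval x := fun x => by simp [hU]
  have hUa : U.eval a = 1 := by
    rw [hUx, hRa, ← hv, mul_one, inv_mul_cancel₀ (by positivity)]
  have hUd : U.natDegree ≤ (s + 2 * r * q) * m := by
    have h1 : V.natDegree ≤ s * m := hVd.trans (natDegree_pow_le.trans
      (Nat.mul_le_mul_left _ ((natDegree_fejerPoly_le m).trans (Nat.sub_le _ _))))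
    have h2 : 2 * r * q ≤ 2 * r * q * m := Nat.le_mul_of_pos_right _ hm
    rw [add_mul]
    exact natDegree_mul_le.trans (add_le_add ((natDegree_C_mul_le _ _).trans h1) (hRd.trans h2))
  have hUb : ∀ x ∈ Icc (-1 : ℝ) 1, 0 ≤ U.eval x ∧
      U.eval x * (1 + m * chordDist x a) ^ (2 * M) ≤ N := by
    intro x hx
    have h1 := one_add_pow_mul_fejerPoly_pow_le hm (mul_add_sqrt_mem_Icc hx haI)
      (two_mul_chordDist_sq hx haI).le s
    have h2 := one_add_pow_mul_fejerPoly_pow_le hm (mul_sub_sqrt_mem_Icc hx haI)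
      (chordDist_sq_le_sub hx haI) s
    have h3 := pow_nonneg (fejerPoly_nonneg hm (mul_add_sqrt_mem_Icc hx haI)) s
    have h4 := pow_nonneg (fejerPoly_nonneg hm (mul_sub_sqrt_mem_Icc hx haI)) s
    have hd := chordDist_nonneg x a
    have hV0 : 0 ≤ V.eval x := by
      rw [hV x hx, eval_pow, eval_pow]
      exact add_nonneg h3 h4
    refine ⟨?_, ?_⟩
    · rw [hUx]
      exact mul_nonneg (mul_nonneg (by positivity) hV0) (hR0 x)
    · rw [hUx]
      calc _ ≤ 1 * V.eval x * (1 + m * chordDist x a) ^ (2 * (r * q))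
            * (1 + m * chordDist x a) ^ (2 * M) := by
            gcongr
            · exact hR0 x
            · exact inv_le_one_of_one_le₀ hv1
            · exact hR1 x
        _ = (1 + m * chordDist x a) ^ (2 * s) * V.eval x := by
            rw [hs, mul_add, pow_add]; ring
        _ ≤ _ := by
            rw [hV x hx, eval_pow, eval_pow, hN, mul_add]
            push_cast
            linarith
  obtain ⟨F, hFd, hFU, hF1, hF⟩ := exists_peaking_polynomial N hN1 U
  have hFx : ∀ x ∈ Icc (-1 : ℝ) 1, 0 ≤ F.eval x ∧ F.eval x ≤ 1 ∧ F.eval x ≤ 3 * U.eval x := by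
    intro x hx
    obtain ⟨h1, h2⟩ := hUb x hx
    refine hF x h1 (le_trans (le_mul_of_one_le_right h1 (one_le_pow₀ ?_)) h2)
    exact le_add_of_nonneg_right (mul_nonneg hm0.le (chordDist_nonneg x a))
  refine ⟨1 - (1 - F) ^ r, ?_, ?_, fun b hb hba => ?_, fun x hx => ?_⟩
  · have h1 : (1 - F).natDegree ≤ (N + 1) * ((s + 2 * r * q) * m) :=
      (natDegree_sub_le _ _).trans (max_le (by simp) (hFd.trans (Nat.mul_le_mul_left _ hUd)))
    refine (natDegree_sub_le _ _).trans (max_le (by simp) (natDegree_pow_le.trans ?_))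
    calc _ ≤ r * ((N + 1) * ((s + 2 * r * q) * m)) := Nat.mul_le_mul_left _ h1
      _ = _ := by ring
  · rw [sub_sub_cancel]
    refine pow_dvd_pow_of_dvd (dvd_iff_isRoot.2 ?_) _
    simp [hF1 a hUa]
  · have h1 : F ∣ 1 - (1 - F) ^ r := by
      simpa using sub_dvd_pow_sub_pow (1 : ℝ[X]) (1 - F) r
    exact (((hRdvd b hb hba).mul_left _).trans hFU).trans h1
  · obtain ⟨h0, h1, h2⟩ := hFx x hx
    obtain ⟨-, hU2⟩ := hUb x hx
    have hd := chordDist_nonneg x a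
    simp only [eval_sub, eval_pow, eval_one]
    refine ⟨sub_nonneg.2 (pow_le_one₀ (by linarith) (by linarith)),
      sub_le_self _ (pow_nonneg (by linarith) _), ?_⟩
    have hB := one_add_mul_le_pow (show -2 ≤ -F.eval x by linarith) r
    rw [← sub_eq_add_neg] at hB
    calc _ ≤ (r * (3 * U.eval x)) * (1 + m * chordDist x a) ^ (2 * M) := by
          gcongr
          have : (r : ℝ) * F.eval x ≤ r * (3 * U.eval x) := by gcongr
          linarith
      _ = r * (3 * (U.eval x * (1 + m * chordDist x a) ^ (2 * M))) := by ring
      _ ≤ _ := by gcongr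

theorem exists_adapted_partition_of_unity (M q r : ℕ) : ∃ C0 : ℝ, 0 ≤ C0 ∧ ∃ L : ℕ,
    ∀ Z : Finset ℝ, Z.card ≤ q → (∀ a ∈ Z, a ∈ Icc (-1 : ℝ) 1) → ∀ m : ℕ, 1 ≤ m →
      (∀ a ∈ Z, ∀ b ∈ Z, a ≠ b → 2 / (m : ℝ) ≤ |a - b|) →
      ∃ (ι : Type) (_ : Fintype ι) (w : ι → ℝ[X]) (c : ι → ℝ), (∀ i, c i ∈ Icc (-1 : ℝ) 1) ∧
        ∑ i, w i = 1 ∧ (∀ i, ∀ x ∈ Icc (-1 : ℝ) 1, 0 ≤ (w i).eval x) ∧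
        (∀ i, (w i).natDegree ≤ L * m) ∧
        (∀ a ∈ Z, ∃ i₀, c i₀ = a ∧ ∀ i, i ≠ i₀ → (X - C a) ^ r ∣ w i) ∧
        ∀ x ∈ Icc (-1 : ℝ) 1,
          ∑ i, (w i).eval x * (1 + m * chordDist x (c i)) ^ (2 * M) ≤ C0 := by
  obtain ⟨C1, hC1, L1, hnode⟩ := exists_node_polynomial M q r
  refine ⟨4 ^ M * (M + 1) + q * C1, by positivity, (M + 1) + q * L1, ?_⟩
  intro Z hZ hZI m hm hsep
  suffices H : ∀ T ⊆ Z, ∃ (ι : Type) (_ : Fintype ι) (w : ι → ℝ[X]) (c : ι → ℝ),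
      (∀ i, c i ∈ Icc (-1 : ℝ) 1) ∧
        ∑ i, w i = 1 ∧ (∀ i, ∀ x ∈ Icc (-1 : ℝ) 1, 0 ≤ (w i).eval x) ∧
        (∀ i, (w i).natDegree ≤ (M + 1 + T.card * L1) * m) ∧
        (∀ a ∈ T, ∃ i₀, c i₀ = a ∧ ∀ i, i ≠ i₀ → (X - C a) ^ r ∣ w i) ∧
        ∀ x ∈ Icc (-1 : ℝ) 1, ∑ i, (w i).eval x * (1 + m * chordDist x (c i)) ^ (2 * M)
          ≤ 4 ^ M * (M + 1) + T.card * C1 by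
    obtain ⟨ι, hι, w, c, h1, h2, h3, h4, h5, h6⟩ := H Z subset_rfl
    refine ⟨ι, hι, w, c, h1, h2, h3, fun i => (h4 i).trans ?_, h5, fun x hx => (h6 x hx).trans ?_⟩
    · gcongr
    · gcongr
  intro T
  induction T using Finset.induction_on with
  | empty =>
    intro _
    obtain ⟨ι, hι, w, c, h1, h2, h3, h4, h5⟩ := exists_partition_of_unity M hm
    exact ⟨ι, hι, w, c, h1, h2, h3, by simpa using h4, by simp, by simpa using h5⟩
  | insert a T haT ih =>
    intro hTZ
    obtain ⟨ι, hι, w, c, h1, h2, h3, h4, h5, h6⟩ := ih ((Finset.subset_insert _ _).trans hTZ)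
    have haZ : a ∈ Z := hTZ (Finset.mem_insert_self _ _)
    obtain ⟨S, hSd, hSa, hSb, hSx⟩ := hnode Z hZ hZI m hm hsep a haZ
    refine ⟨Option ι, inferInstance, fun i => i.elim S fun i => (1 - S) * w i,
      fun i => i.elim a c, ?_, ?_, ?_, ?_, ?_, ?_⟩
    · rintro (_ | i)
      · exact hZI a haZ
      · exact h1 i
    · simp [Fintype.sum_option, ← Finset.mul_sum, h2]
    · rintro (_ | i) x hx
      · exact (hSx x hx).1
      · simp only [Option.elim_some, eval_mul, eval_sub, eval_one]
        exact mul_nonneg (sub_nonneg.2 (hSx x hx).2.1) (h3 i x hx)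
    · rw [Finset.card_insert_of_notMem haT]
      have h7 : (1 - S).natDegree ≤ L1 * m :=
        (natDegree_sub_le _ _).trans (max_le (by simp) hSd)
      rintro (_ | i)
      · refine hSd.trans (Nat.mul_le_mul_right _ ?_)
        rw [add_mul]
        omega
      · refine (natDegree_mul_le.trans (add_le_add h7 (h4 i))).trans_eq ?_
        ring
    · intro b hb
      rcases Finset.mem_insert.1 hb with rfl | hbT
      · refine ⟨none, rfl, ?_⟩
        rintro (_ | i) hi
        · exact absurd rfl hi
        · exact hSa.mul_right _
      · obtain ⟨i₀, hi₀, hdvd⟩ := h5 b hbT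
        refine ⟨some i₀, hi₀, ?_⟩
        rintro (_ | i) hi
        · exact hSb b (hTZ hb) fun h => haT (h ▸ hbT)
        · exact (hdvd i fun h => hi (by rw [h])).mul_left _
    · intro x hx
      obtain ⟨hS0, hS1, hS2⟩ := hSx x hx
      rw [Fintype.sum_option, Finset.card_insert_of_notMem haT]
      simp only [Option.elim_none, Option.elim_some, eval_mul, eval_sub, eval_one]
      have h8 : ∑ i, (1 - S.eval x) * (w i).eval x * (1 + m * chordDist x (c i)) ^ (2 * M)
          ≤ 4 ^ M * (M + 1) + T.card * C1 := by
        refine (Finset.sum_le_sum fun i _ => ?_).trans (h6 x hx)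
        have hd := chordDist_nonneg x (c i)
        have := h3 i x hx
        exact mul_le_mul_of_nonneg_right (mul_le_of_le_one_left this (by linarith)) (by positivity)
      push_cast
      linarith

theorem rho_le_two_div {m : ℕ} (hm : 1 ≤ m) (x : ℝ) : rho m x ≤ 2 / m := by
  have hm0 : (1 : ℝ) ≤ m := by exact_mod_cast hm
  have h1 : √(1 - x ^ 2) ≤ 1 := Real.sqrt_le_one.2 (by nlinarith)
  have h2 : 1 / (m : ℝ) ^ 2 ≤ 1 / m :=
    one_div_le_one_div_of_le (by positivity) (by nlinarith)
  have h3 : √(1 - x ^ 2) / m ≤ 1 / m := by gcongr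
  unfold rho
  linarith [show (2 : ℝ) / m = 1 / m + 1 / m by ring]

theorem exists_onesided_of_separated {k : ℕ} (hk : 1 ≤ k) (r q : ℕ) :
    ∃ B : ℝ, 0 ≤ B ∧ ∃ L : ℕ, 1 ≤ L ∧ ∀ Z : Finset ℝ, Z.card ≤ q →
      (∀ a ∈ Z, a ∈ Icc (-1 : ℝ) 1) → ∀ m : ℕ, 1 ≤ m → 4 * k ^ 2 ≤ m →
      (∀ a ∈ Z, ∀ b ∈ Z, a ≠ b → 2 / (m : ℝ) ≤ |a - b|) →
      ∀ f : ℝ → ℝ, ContDiffOn ℝ r f (Icc (-1) 1) → ∃ P : ℝ[X], P.natDegree ≤ L * m ∧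
        (∀ x ∈ Icc (-1 : ℝ) 1, f x ≤ P.eval x ∧ P.eval x - f x ≤ B * (rho m x ^ r *
          omegaK (iteratedDerivWithin r f (Icc (-1) 1)) k (rho m x) (-1) 1)) ∧
        ∀ a ∈ Z, (∀ i < 2 * (r / 2),
            (derivative^[i] P).eval a = iteratedDerivWithin i f (Icc (-1) 1) a) ∧
          (a = 1 ∨ a = -1 → ∀ i < r,
            (derivative^[i] P).eval a = iteratedDerivWithin i f (Icc (-1) 1) a) := by
  obtain ⟨A, hA, K, M, hloc⟩ := exists_onesided_local hk r
  obtain ⟨C0, hC0, L, hpart⟩ := exists_adapted_partition_of_unity (r + k + M) q r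
  refine ⟨A * (2 ^ r * 3 ^ k * 2 ^ M) * C0, by positivity, L + K + 1, by omega, ?_⟩
  intro Z hZ hZI m hm hkm hsep f hf
  have hm0 : (0 : ℝ) < m := by exact_mod_cast hm
  obtain ⟨ι, hι, w, c, hc, hw1, hw0, hwd, hwZ, hwM⟩ := hpart Z hZ hZI m hm hsep
  have hstep : ∀ y, 2 * (k : ℝ) ^ 2 * rho m y ≤ 1 := by
    intro y
    have h1 : (4 : ℝ) * k ^ 2 ≤ m := by exact_mod_cast hkm
    calc 2 * (k : ℝ) ^ 2 * rho m y ≤ 2 * (k : ℝ) ^ 2 * (2 / m) := by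
          gcongr
          exact rho_le_two_div hm y
      _ = 4 * (k : ℝ) ^ 2 / m := by ring
      _ ≤ 1 := (div_le_one hm0).2 h1
  choose p hpd hpx hpi hpe using fun i =>
    hloc f hf (c i) (hc i) (rho m (c i)) (rho_pos hm _) (hstep _)
  have hcont : ContinuousOn (iteratedDerivWithin r f (Icc (-1) 1)) (Icc (-1) 1) :=
    hf.continuousOn_iteratedDerivWithin le_rfl (uniqueDiffOn_Icc (by norm_num))
  have hwx : ∀ x, ∑ i, (w i).eval x = 1 := fun x => by
    rw [← eval_finsetSum, hw1, eval_one]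
  have hPf : ∀ x, (∑ i, w i * p i).eval x - f x = ∑ i, (w i).eval x * ((p i).eval x - f x) := by
    intro x
    simp only [eval_finsetSum, eval_mul, mul_sub, Finset.sum_sub_distrib]
    rw [← Finset.sum_mul, hwx, one_mul]
  have hderiv : ∀ i₀ : ι, (∀ i, i ≠ i₀ → (X - C (c i₀)) ^ r ∣ w i) → ∀ l < r,
      (derivative^[l] (∑ i, w i * p i)).eval (c i₀) = (derivative^[l] (p i₀)).eval (c i₀) := by
    intro i₀ h l hl
    have h1 : ∑ i, w i * p i - p i₀ = ∑ i, w i * (p i - p i₀) := by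
      simp only [mul_sub, Finset.sum_sub_distrib]
      rw [← Finset.sum_mul, hw1, one_mul]
    have h2 : (X - C (c i₀)) ^ r ∣ ∑ i, w i * p i - p i₀ := by
      rw [h1]
      refine Finset.dvd_sum fun i _ => ?_
      rcases eq_or_ne i i₀ with rfl | hi
      · simp
      · exact (h i hi).mul_right _
    have h3 := eval_iterate_derivative_eq_zero_of_dvd h2 hl
    rwa [iterate_derivative_sub, eval_sub, sub_eq_zero] at h3
  refine ⟨∑ i, w i * p i, ?_, fun x hx => ⟨?_, ?_⟩, fun a ha => ?_⟩
  · refine natDegree_sum_le_of_forall_le _ _ fun i _ => ?_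
    refine (natDegree_mul_le.trans (add_le_add (hwd i) (hpd i))).trans ?_
    have : K ≤ K * m := Nat.le_mul_of_pos_right _ hm
    rw [add_mul, add_mul]
    omega
  · rw [← sub_nonneg, hPf]
    exact Finset.sum_nonneg fun i _ => mul_nonneg (hw0 i x hx) (sub_nonneg.2 (hpx i x hx).1)
  · set ω := omegaK (iteratedDerivWithin r f (Icc (-1) 1)) k (rho m x) (-1) 1
    have hω : 0 ≤ ω := omegaK_nonneg _ _ _ _ _
    have hρ := rho_pos hm x
    have hterm : ∀ i, (p i).eval x - f x ≤ A * (2 ^ r * 3 ^ k * 2 ^ M) * (rho m x ^ r * ω) *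
        (1 + m * chordDist x (c i)) ^ (2 * (r + k + M)) := by
      intro i
      refine (hpx i x hx).2.trans ?_
      set h := rho m (c i)
      have hh : 0 < h := rho_pos hm _
      have hd : 0 ≤ m * chordDist x (c i) := mul_nonneg hm0.le (chordDist_nonneg _ _)
      have e1 : h ≤ (1 + 2 * (m * chordDist x (c i))) * rho m x := rho_le_mul_rho hm x (c i)
      have e2 : |x - c i| ≤ 2 * (m * chordDist x (c i)) * (1 + m * chordDist x (c i)) * h :=
        abs_sub_le_mul_rho hm hx (hc i)
      set d := m * chordDist x (c i)
      have e3 : h ≤ 2 * (1 + d) * rho m x := e1.trans (by gcongr; linarith)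
      have e4 : 1 + |x - c i| / h ≤ 2 * (1 + d) ^ 2 := by
        have : |x - c i| / h ≤ 2 * d * (1 + d) := (div_le_iff₀ hh).2 e2
        nlinarith
      have e5 : omegaK (iteratedDerivWithin r f (Icc (-1) 1)) k h (-1) 1
          ≤ (3 * (1 + d)) ^ k * ω := by
        have hceil := Nat.ceil_lt_add_one (show 0 ≤ 2 * (1 + d) by positivity)
        refine (omegaK_le_nat_pow_mul hcont (m := ⌈2 * (1 + d)⌉₊)
          (t := rho m x) (Nat.one_le_ceil_iff.2 (by positivity)) (e3.trans ?_)).trans ?_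
        · gcongr
          exact Nat.le_ceil _
        · gcongr
          linarith
      calc _ ≤ A * ((2 * (1 + d) * rho m x) ^ r * ((3 * (1 + d)) ^ k * ω)
            * (2 * (1 + d) ^ 2) ^ M) := by
            gcongr
            exact omegaK_nonneg _ _ _ _ _
        _ = A * (2 ^ r * 3 ^ k * 2 ^ M) * (rho m x ^ r * ω) * (1 + d) ^ (r + k + 2 * M) := by
            simp only [mul_pow, pow_add, pow_mul]
            ring
        _ ≤ _ := by
            gcongr
            · linarith
            · omega
    rw [hPf]
    calc _ ≤ ∑ i, (w i).eval x * (A * (2 ^ r * 3 ^ k * 2 ^ M) * (rho m x ^ r * ω) *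
          (1 + m * chordDist x (c i)) ^ (2 * (r + k + M))) :=
          Finset.sum_le_sum fun i _ => mul_le_mul_of_nonneg_left (hterm i) (hw0 i x hx)
      _ = A * (2 ^ r * 3 ^ k * 2 ^ M) * (rho m x ^ r * ω) *
          ∑ i, (w i).eval x * (1 + m * chordDist x (c i)) ^ (2 * (r + k + M)) := by
          rw [Finset.mul_sum]
          exact Finset.sum_congr rfl fun i _ => by ring
      _ ≤ A * (2 ^ r * 3 ^ k * 2 ^ M) * (rho m x ^ r * ω) * C0 := by
          gcongr
          exact hwM x hx
      _ = _ := by ring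
  · obtain ⟨i₀, rfl, hdvd⟩ := hwZ a ha
    exact ⟨fun l hl => (hderiv i₀ hdvd l (by omega)).trans (hpi i₀ l hl),
      fun he l hl => (hderiv i₀ hdvd l hl).trans (hpe i₀ he l hl)⟩

theorem minGap_pos {S : Set ℝ} (hS : S.Finite) (hS' : S.Nontrivial) : 0 < minGap S := by
  have hfin : {d : ℝ | ∃ u ∈ S, ∃ v ∈ S, u ≠ v ∧ d = |u - v|}.Finite := by
    refine ((hS.prod hS).image fun z => |z.1 - z.2|).subset ?_
    rintro d ⟨u, hu, v, hv, -, rfl⟩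
    exact ⟨(u, v), ⟨hu, hv⟩, rfl⟩
  obtain ⟨u, hu, v, hv, huv⟩ := hS'
  obtain ⟨u', -, v', -, hne, h⟩ :=
    Set.Nonempty.csInf_mem (⟨_, u, hu, v, hv, huv, rfl⟩ :
      {d : ℝ | ∃ u ∈ S, ∃ v ∈ S, u ≠ v ∧ d = |u - v|}.Nonempty) hfin
  rw [minGap, h]
  exact abs_pos.2 (sub_ne_zero.2 hne)

theorem minGap_le {S : Set ℝ} {u v : ℝ} (hu : u ∈ S) (hv : v ∈ S) (huv : u ≠ v) :
    minGap S ≤ |u - v| := by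
  refine csInf_le ⟨0, ?_⟩ ⟨u, hu, v, hv, huv, rfl⟩
  rintro d ⟨u, -, v, -, -, rfl⟩
  exact abs_nonneg _

theorem rho_le_of_le_mul {m n l : ℕ} (hm : 1 ≤ m) (hn : 1 ≤ n) (hl : 1 ≤ l) (hnm : n ≤ l * m)
    (x : ℝ) : rho m x ≤ (l ^ 2 : ℕ) * rho n x := by
  have hm0 : (0 : ℝ) < m := by exact_mod_cast hm
  have hn0 : (0 : ℝ) < n := by exact_mod_cast hn
  have hl0 : (1 : ℝ) ≤ l := by exact_mod_cast hl
  have h : (n : ℝ) ≤ l * m := by exact_mod_cast hnm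
  have hs := Real.sqrt_nonneg (1 - x ^ 2)
  have h1 : 1 / (m : ℝ) ≤ l / n := by
    rw [div_le_div_iff₀ hm0 hn0]
    linarith
  have h2 : 1 / (m : ℝ) ^ 2 ≤ l ^ 2 / n ^ 2 := by
    rw [← div_pow, ← one_div_pow]
    gcongr
  have h3 : (l : ℝ) / n ≤ l ^ 2 / n := by
    gcongr
    nlinarith
  unfold rho
  push_cast
  calc √(1 - x ^ 2) / m + 1 / (m : ℝ) ^ 2
      = √(1 - x ^ 2) * (1 / m) + 1 / (m : ℝ) ^ 2 := by ring
    _ ≤ √(1 - x ^ 2) * (l ^ 2 / n) + l ^ 2 / n ^ 2 :=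
        add_le_add (mul_le_mul_of_nonneg_left (h1.trans h3) hs) h2
    _ = _ := by ring

end

/-- Onesided polynomial approximation with interpolatory constraints:
for `(r, m₁, m₃) ∈ {(2j, 2j-1, 2j-1) : j ≥ 1} ∪ {(2j+1, 2j-1, 2j) : j ≥ 0}`
there is `c = c(k,r,p) > 0` and, for every `A_p`, a threshold `N` depending only on
`d(A_p)`, such that for every `f ∈ C^r[-1,1]` and `n ≥ N` there is a polynomial `P_n`
of degree ≤ n with `P_n ≥ f` on `[-1,1]`, Hermite interpolation of order `m₁` at the
points of `A_p` (vacuous if `m₁ = -1`) and of order `m₃` at `±1`, and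
`|f(x) - P_n(x)| ≤ c ρ_n^r(x) ω_k(f^{(r)}, ρ_n(x))` on `[-1,1]`. -/
theorem statement2 (k p : ℕ) (hk : 1 ≤ k) (hp : 1 ≤ p)
    (r : ℕ) (m₁ : ℤ) (m₃ : ℕ)
    (hm : (∃ j : ℕ, 1 ≤ j ∧ r = 2 * j ∧ m₁ = 2 * (j : ℤ) - 1 ∧ m₃ = 2 * j - 1)
        ∨ (∃ j : ℕ, r = 2 * j + 1 ∧ m₁ = 2 * (j : ℤ) - 1 ∧ m₃ = 2 * j)) :
    ∃ c : ℝ, 0 < c ∧ ∃ Nf : ℝ → ℕ,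
      ∀ (α : Fin p → ℝ), StrictAnti α → (∀ j, α j ∈ Set.Icc (-1 : ℝ) 1) →
      ∀ f : ℝ → ℝ, ContDiffOn ℝ r f (Set.Icc (-1 : ℝ) 1) →
      ∀ n : ℕ, Nf (minGap (Set.range α ∪ {-1, 1})) ≤ n →
      ∃ P : Polynomial ℝ, P.natDegree ≤ n ∧
        (∀ x ∈ Set.Icc (-1 : ℝ) 1, f x ≤ P.eval x) ∧
        (∀ i : ℕ, (i : ℤ) ≤ m₁ → ∀ j : Fin p,
          (Polynomial.derivative^[i] P).eval (α j)
            = iteratedDerivWithin i f (Set.Icc (-1 : ℝ) 1) (α j)) ∧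
        (∀ i : ℕ, i ≤ m₃ →
          (Polynomial.derivative^[i] P).eval 1
            = iteratedDerivWithin i f (Set.Icc (-1 : ℝ) 1) 1 ∧
          (Polynomial.derivative^[i] P).eval (-1)
            = iteratedDerivWithin i f (Set.Icc (-1 : ℝ) 1) (-1)) ∧
        ∀ x ∈ Set.Icc (-1 : ℝ) 1,
          |f x - P.eval x| ≤ c * rho n x ^ r *
            omegaK (iteratedDerivWithin r f (Set.Icc (-1 : ℝ) 1)) k (rho n x) (-1) 1 := by
  obtain ⟨B, hB, L, hL, happrox⟩ := exists_onesided_of_separated hk r (p + 2)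
  refine ⟨B * (((2 * L) ^ 2 : ℕ) : ℝ) ^ r * (((2 * L) ^ 2 : ℕ) : ℝ) ^ k + 1, by positivity,
    fun d => L * (⌈2 / d⌉₊ + 4 * k ^ 2 + 1), ?_⟩
  intro α _ hα f hf n hn
  set d := minGap (Set.range α ∪ {-1, 1})
  have hd : 0 < d := minGap_pos ((Set.finite_range α).union (Set.toFinite _))
    ⟨-1, by simp, 1, by simp, by norm_num⟩
  set m := n / L
  have hm1 : ⌈2 / d⌉₊ + 4 * k ^ 2 + 1 ≤ m := by
    rw [Nat.le_div_iff_mul_le (by omega), mul_comm]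
    exact hn
  have hm : 1 ≤ m := by omega
  have hm0 : (0 : ℝ) < m := by exact_mod_cast hm
  have hLm : L * m ≤ n := Nat.mul_div_le n L
  have hnm : n ≤ 2 * L * m := by
    have h1 : n < L * (m + 1) := Nat.lt_mul_div_succ n (by omega)
    nlinarith
  have hn1 : 1 ≤ n := (Nat.mul_pos hL hm).trans_le hLm
  have hcard : (insert 1 (insert (-1) (Finset.univ.image α))).card ≤ p + 2 := by
    have h1 := Finset.card_insert_le (1 : ℝ) (insert (-1) (Finset.univ.image α))
    have h2 := Finset.card_insert_le (-1 : ℝ) (Finset.univ.image α)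
    have h3 : (Finset.univ.image α).card ≤ p := Finset.card_image_le.trans (by simp)
    omega
  have hmem : ∀ a ∈ insert 1 (insert (-1) (Finset.univ.image α)),
      a ∈ Set.range α ∪ {-1, 1} := by
    intro a ha
    simp only [Finset.mem_insert, Finset.mem_image, Finset.mem_univ, true_and] at ha
    rcases ha with rfl | rfl | ⟨j, rfl⟩ <;> simp
  obtain ⟨P, hP, hPx, hPi⟩ := happrox _ hcard
    (by
      intro a ha
      rcases hmem a ha with ⟨j, rfl⟩ | rfl | rfl
      · exact hα j
      · norm_num
      · norm_num)
    m hm (by omega)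
    (by
      intro a ha b hb hab
      refine le_trans ?_ (minGap_le (hmem a ha) (hmem b hb) hab)
      rw [div_le_comm₀ hm0 hd]
      refine (Nat.le_ceil _).trans ?_
      exact_mod_cast (by omega : ⌈2 / d⌉₊ ≤ m))
    f hf
  refine ⟨P, hP.trans hLm, fun x hx => (hPx x hx).1, fun i hi j => ?_, fun i hi => ⟨?_, ?_⟩,
    fun x hx => ?_⟩
  · exact (hPi (α j) (by simp)).1 i (by omega)
  · exact (hPi 1 (by simp)).2 (by simp) i (by omega)
  · exact (hPi (-1) (by simp)).2 (by simp) i (by omega)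
  · have hρ := rho_pos hm x
    have hρn := rho_pos hn1 x
    have hρle : rho m x ≤ ((2 * L) ^ 2 : ℕ) * rho n x :=
      rho_le_of_le_mul hm hn1 (by omega) hnm x
    have hω := omegaK_le_nat_pow_mul (k := k) (hf.continuousOn_iteratedDerivWithin le_rfl
      (uniqueDiffOn_Icc (by norm_num))) (Nat.one_le_pow _ _ (by omega)) hρle
    have hω0 := omegaK_nonneg (iteratedDerivWithin r f (Set.Icc (-1 : ℝ) 1)) k (rho m x) (-1) 1
    have hω1 := omegaK_nonneg (iteratedDerivWithin r f (Set.Icc (-1 : ℝ) 1)) k (rho n x) (-1) 1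
    rw [abs_sub_comm, abs_of_nonneg (sub_nonneg.2 (hPx x hx).1)]
    calc P.eval x - f x ≤ B * (rho m x ^ r *
          omegaK (iteratedDerivWithin r f (Set.Icc (-1 : ℝ) 1)) k (rho m x) (-1) 1) :=
          (hPx x hx).2
      _ ≤ B * ((((2 * L) ^ 2 : ℕ) * rho n x) ^ r * ((((2 * L) ^ 2 : ℕ) : ℝ) ^ k *
          omegaK (iteratedDerivWithin r f (Set.Icc (-1 : ℝ) 1)) k (rho n x) (-1) 1)) := by
          gcongr
      _ = B * (((2 * L) ^ 2 : ℕ) : ℝ) ^ r * (((2 * L) ^ 2 : ℕ) : ℝ) ^ k * rho n x ^ r *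
          omegaK (iteratedDerivWithin r f (Set.Icc (-1 : ℝ) 1)) k (rho n x) (-1) 1 := by
          rw [mul_pow]
          ring
      _ ≤ _ := by
          gcongr
          exact le_add_of_nonneg_right zero_le_one
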